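/- arXiv:1906.10967 — 4 statements merged into one kernel-verified Lean document; each statement's English description precedes it below -/
import Mathlib

section
/- Let Z be a Gaussian random p-vector with mean μ and covariance I_p, and let φ : R → R be a bounded measurable function. Then E[φ(‖Z‖²) Z] = E[φ(V)] μ, where V follows a non-central chi-square distribution with p+2 degrees of freedom and non-centrality parameter ‖μ‖². -/
open MeasureTheory ProbabilityTheory Matrix

/-- The standard Gaussian measure on `ℝ^p` (mean `0`, covariance `I_p`). -/
noncomputable def stdGaussian (p : ℕ) : Measure (Fin p → ℝ) :=
  Measure.pi (fun _ => gaussianReal 0 1)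

lemma aux_unique {Ω Ω' : Type*} [MeasurableSpace Ω] [MeasurableSpace Ω']
    (P : Measure Ω) (Q : Measure Ω') [IsFiniteMeasure P] [IsFiniteMeasure Q]
    (N X : Ω → ℝ) (M : Ω' → ℝ) (hN : Measurable N) (hM : Measurable M) (hX : Measurable X)
    (hXi : Integrable X P) (c : ℝ)
    (h : ∀ s : ℝ, ∫ w, X w • Complex.exp (s * N w * Complex.I) ∂P
      = c • ∫ w, Complex.exp (s * M w * Complex.I) ∂Q)
    (φ : ℝ → ℝ) (hφ : Measurable φ) (C : ℝ) (hC : ∀ x, |φ x| ≤ C) :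
    ∫ w, X w • φ (N w) ∂P = c • ∫ w, φ (M w) ∂Q := by
  have h1 : IsFiniteMeasure (P.withDensity fun x => ENNReal.ofReal (X x)) :=
    isFiniteMeasure_withDensity_ofReal hXi.2
  have h2 : IsFiniteMeasure (P.withDensity fun x => ENNReal.ofReal (-X x)) :=
    isFiniteMeasure_withDensity_ofReal hXi.neg.2
  have h3 : IsFiniteMeasure (ENNReal.ofReal (-c) • Q.map M) :=
    Measure.smul_finite _ ENNReal.ofReal_ne_top
  have h4 : IsFiniteMeasure (ENNReal.ofReal c • Q.map M) :=
    Measure.smul_finite _ ENNReal.ofReal_ne_top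
  set ρ₁ : Measure ℝ := (P.withDensity fun x => ENNReal.ofReal (X x)).map N
    + ENNReal.ofReal (-c) • Q.map M with hρ₁
  set ρ₂ : Measure ℝ := (P.withDensity fun x => ENNReal.ofReal (-X x)).map N
    + ENNReal.ofReal c • Q.map M with hρ₂
  have key : ∀ {E : Type} [NormedAddCommGroup E] [NormedSpace ℝ E] (g : ℝ → E),
      StronglyMeasurable g → (∃ K, ∀ x, ‖g x‖ ≤ K) →
      ∫ x, g x ∂ρ₁ - ∫ x, g x ∂ρ₂ = ∫ w, X w • g (N w) ∂P - c • ∫ w, g (M w) ∂Q := by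
    intro E _ _ g hg ⟨K, hK⟩
    have hgi : ∀ (ν : Measure ℝ) [IsFiniteMeasure ν], Integrable g ν := fun ν _ =>
      Integrable.of_bound hg.aestronglyMeasurable K (ae_of_all _ hK)
    have hgN : ∀ (Y : Ω → ℝ), Integrable Y P → Integrable (fun w => Y w • g (N w)) P := by
      intro Y hY
      refine (hY.norm.mul_const K).mono'
        (hY.aestronglyMeasurable.smul (hg.comp_measurable hN).aestronglyMeasurable)
        (ae_of_all _ fun w => ?_)
      rw [norm_smul]
      exact mul_le_mul_of_nonneg_left (hK _) (norm_nonneg _)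
    rw [hρ₁, hρ₂, integral_add_measure (hgi _) (hgi _), integral_add_measure (hgi _) (hgi _),
      integral_smul_measure, integral_smul_measure,
      integral_map hN.aemeasurable hg.aestronglyMeasurable,
      integral_map hN.aemeasurable hg.aestronglyMeasurable,
      integral_map hM.aemeasurable hg.aestronglyMeasurable,
      integral_withDensity_eq_integral_toReal_smul hX.ennreal_ofReal
        (ae_of_all _ fun _ => ENNReal.ofReal_lt_top),
      integral_withDensity_eq_integral_toReal_smul (f := fun x => ENNReal.ofReal (-X x)) hX.neg.ennreal_ofReal
        (ae_of_all _ fun _ => ENNReal.ofReal_lt_top)]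
    simp only [ENNReal.toReal_ofReal']
    have e1 : ∫ w, X w • g (N w) ∂P = ∫ w, max (X w) 0 • g (N w) ∂P
        - ∫ w, max (-X w) 0 • g (N w) ∂P := by
      rw [← integral_sub (hgN _ hXi.pos_part) (hgN _ hXi.neg_part)]
      refine integral_congr_ae (ae_of_all _ fun w => ?_)
      simp only
      rw [← sub_smul]
      congr 1
      rcases le_total 0 (X w) with h | h
      · rw [max_eq_left h, max_eq_right (by linarith)]; ring
      · rw [max_eq_right h, max_eq_left (by linarith)]; ring
    have e2 : c = max c 0 - max (-c) 0 := by
      rcases le_total 0 c with h | h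
      · rw [max_eq_left h, max_eq_right (by linarith)]; ring
      · rw [max_eq_right h, max_eq_left (by linarith)]; ring
    rw [e1]
    conv_rhs => rw [e2, sub_smul]
    abel
  have hρ : ρ₁ = ρ₂ := by
    apply Measure.ext_of_charFun
    ext s
    rw [charFun_apply_real, charFun_apply_real]
    have := key (fun x : ℝ => Complex.exp (s * x * Complex.I))
      (by apply Continuous.stronglyMeasurable; fun_prop)
      ⟨1, fun x => by rw [← Complex.ofReal_mul, Complex.norm_exp_ofReal_mul_I]⟩
    rw [h s, sub_self, sub_eq_zero] at this
    exact this
  have := key φ hφ.stronglyMeasurable ⟨C, hC⟩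
  rw [hρ, sub_self] at this
  exact (sub_eq_zero.mp this.symm)

lemma aux_gauss (s : ℝ) : ∃ C κ : ℂ,
    (∀ a : ℝ, ∫ x, Complex.exp (s * ((a + x) ^ 2 : ℝ) * Complex.I) ∂(gaussianReal 0 1)
      = C * Complex.exp (κ * a ^ 2)) ∧
    (∀ a : ℝ, ∫ x, ((a + x : ℝ) : ℂ) * Complex.exp (s * ((a + x) ^ 2 : ℝ) * Complex.I)
        ∂(gaussianReal 0 1) = a * C ^ 2 * (C * Complex.exp (κ * a ^ 2))) := by
  set b : ℂ := s * Complex.I - 1 / 2 with hb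
  have hbre : b.re < 0 := by simp [hb]
  have hb0 : b ≠ 0 := by intro h; rw [h] at hbre; simp at hbre
  set r : ℂ := (((√(2 * Real.pi))⁻¹ : ℝ) : ℂ) with hr
  set C : ℂ := r * (Real.pi / -b) ^ (1 / 2 : ℂ) with hC
  have hC2 : C ^ 2 = -1 / (2 * b) := by
    have hpi : (Real.pi : ℂ) ≠ 0 := by exact_mod_cast Real.pi_ne_zero
    have h1 : ((Real.pi / -b) ^ (1 / 2 : ℂ)) ^ 2 = Real.pi / -b := by
      rw [← Complex.cpow_nat_mul]; norm_num
    have h2 : r ^ 2 = (2 * (Real.pi : ℂ))⁻¹ := by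
      rw [hr, ← Complex.ofReal_pow, inv_pow, Real.sq_sqrt (by positivity)]
      push_cast; ring
    rw [hC, mul_pow, h1, h2]
    field_simp
  have hpdf : ∀ a x : ℝ, gaussianPDFReal 0 1 x •
      Complex.exp (s * ((a + x) ^ 2 : ℝ) * Complex.I) =
      r * Complex.exp (b * x ^ 2 + (2 * s * a * Complex.I) * x + s * a ^ 2 * Complex.I) := by
    intro a x
    rw [gaussianPDFReal_def, Complex.real_smul]
    simp only [NNReal.coe_one, mul_one, sub_zero]
    rw [Complex.ofReal_mul, Complex.ofReal_exp, mul_assoc, ← Complex.exp_add, hr, hb]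
    congr 2
    push_cast
    ring
  have hF : ∀ a : ℝ, ∫ x, Complex.exp (s * ((a + x) ^ 2 : ℝ) * Complex.I) ∂(gaussianReal 0 1)
      = C * Complex.exp ((s * Complex.I + s ^ 2 / b) * a ^ 2) := by
    intro a
    rw [integral_gaussianReal_eq_integral_smul one_ne_zero]
    simp_rw [hpdf]
    rw [integral_const_mul, integral_cexp_quadratic hbre, hC, mul_assoc r]
    have he : (s * a ^ 2 * Complex.I - (2 * s * a * Complex.I) ^ 2 / (4 * b) : ℂ)
        = (s * Complex.I + s ^ 2 / b) * a ^ 2 := by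
      field_simp
      linear_combination (-4 * (s : ℂ) ^ 2 * a ^ 2) * Complex.I_sq
    rw [he]
  refine ⟨C, s * Complex.I + s ^ 2 / b, hF, fun a => ?_⟩
  rw [← hF a, integral_gaussianReal_eq_integral_smul one_ne_zero,
    integral_gaussianReal_eq_integral_smul one_ne_zero]
  simp_rw [hpdf]
  set f : ℝ → ℂ := fun x =>
    Complex.exp (b * x ^ 2 + (2 * s * a * Complex.I) * x + s * a ^ 2 * Complex.I) with hf
  have hfi : Integrable f := integrable_cexp_quadratic' hbre _ _
  have hxf : Integrable (fun x : ℝ => (x : ℂ) * f x) := by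
    refine (integrable_mul_exp_neg_mul_sq (b := 1 / 2) (by norm_num)).norm.mono'
      (by apply Continuous.aestronglyMeasurable; fun_prop) (ae_of_all _ fun x => ?_)
    rw [norm_mul, norm_mul, Complex.norm_real, hf]
    apply mul_le_mul_of_nonneg_left _ (norm_nonneg _)
    simp only
    rw [Complex.norm_exp, Real.norm_eq_abs, Real.abs_exp]
    apply le_of_eq
    congr 1
    simp [hb, pow_two]
  have hd : ∀ x : ℝ, HasDerivAt f (2 * b * ((x : ℂ) * f x) + (2 * s * a * Complex.I) * f x) x := by
    intro x
    have h0 : HasDerivAt (fun x : ℝ => (x : ℂ)) 1 x := Complex.ofRealCLM.hasDerivAt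
    have h1 : HasDerivAt (fun x : ℝ => b * (x : ℂ) ^ 2 + (2 * s * a * Complex.I) * x
        + s * a ^ 2 * Complex.I) (b * (2 * x) + 2 * s * a * Complex.I) x := by
      have := (((h0.pow 2).const_mul b).add (h0.const_mul (2 * s * a * Complex.I))).add_const
        (s * a ^ 2 * Complex.I)
      exact this.congr_deriv (by simp)
    convert h1.cexp using 1
    simp only [hf]
    ring
  have hz := integral_eq_zero_of_hasDerivAt_of_integrable hd
    ((hxf.const_mul _).add (hfi.const_mul _)) hfi
  rw [integral_add (hxf.const_mul _) (hfi.const_mul _), integral_const_mul,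
    integral_const_mul] at hz
  have hs : ∀ x : ℝ, gaussianPDFReal 0 1 x • (((a + x : ℝ) : ℂ) *
      Complex.exp (s * ((a + x) ^ 2 : ℝ) * Complex.I)) = r * (a * f x + x * f x) := by
    intro x
    rw [Complex.real_smul, mul_left_comm, ← Complex.real_smul (x := gaussianPDFReal 0 1 x), hpdf]
    simp only [hf]
    push_cast
    ring
  simp_rw [hs]
  have hfe : ∫ x : ℝ, r * Complex.exp (b * x ^ 2 + (2 * s * a * Complex.I) * x
      + s * a ^ 2 * Complex.I) = r * ∫ x, f x := integral_const_mul _ _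
  rw [hfe, integral_const_mul, integral_add (hfi.const_mul _) hxf,
    integral_const_mul, hC2]
  have hx : ∫ x : ℝ, (x : ℂ) * f x = - (2 * s * a * Complex.I) / (2 * b) * ∫ x, f x := by
    field_simp
    linear_combination hz / 2
  rw [hx]
  generalize ∫ x, f x = F
  have hs2 : (s : ℂ) * Complex.I = b + 1 / 2 := by rw [hb]; ring
  field_simp
  linear_combination (-2 * a * F * r) * hs2

theorem stmt5 (p : ℕ) (μ : Fin p → ℝ) (φ : ℝ → ℝ)
    (hφm : Measurable φ) (hφb : ∃ Cb, ∀ x, |φ x| ≤ Cb)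
    (m : Fin (p + 2) → ℝ) (hm : ∑ i, m i ^ 2 = ∑ i, μ i ^ 2) :
    ∀ i, ∫ w, φ (∑ j, (μ j + w j) ^ 2) * (μ i + w i) ∂(stdGaussian p)
      = (∫ v, φ (∑ j, (m j + v j) ^ 2) ∂(stdGaussian (p + 2))) * μ i := by
  intro i
  obtain ⟨B, hB⟩ := hφb
  have : ∀ n, IsProbabilityMeasure (stdGaussian n) := fun n => by
    unfold _root_.stdGaussian; infer_instance
  have := aux_unique (stdGaussian p) (stdGaussian (p + 2)) (fun w => ∑ j, (μ j + w j) ^ 2)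
    (fun w => μ i + w i) (fun v => ∑ j, (m j + v j) ^ 2) (by fun_prop) (by fun_prop)
    (by fun_prop) ?_ (μ i) ?_ φ hφm B hB
  · simp only [smul_eq_mul] at this
    rw [mul_comm (∫ v, _ ∂_), ← this]
    exact integral_congr_ae (ae_of_all _ fun w => mul_comm _ _)
  · refine (integrable_const _).add ?_
    have h1 : Integrable (fun x : ℝ => x) (gaussianReal 0 1) :=
      memLp_one_iff_integrable.mp (memLp_id_gaussianReal 1)
    exact integrable_comp_eval (μ := fun _ : Fin p => gaussianReal 0 1) (i := i) h1
  · intro s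
    obtain ⟨C, κ, h1, h2⟩ := aux_gauss s
    have hprod : ∀ (n : ℕ) (a w : Fin n → ℝ),
        Complex.exp (s * ((∑ j, (a j + w j) ^ 2 : ℝ) : ℂ) * Complex.I)
        = ∏ j, Complex.exp (s * ((a j + w j) ^ 2 : ℝ) * Complex.I) := by
      intro n a w
      rw [← Complex.exp_sum, Complex.ofReal_sum, Finset.mul_sum, Finset.sum_mul]
    have hexp : ∀ (n : ℕ) (a : Fin n → ℝ), ∏ j, (C * Complex.exp (κ * (a j : ℂ) ^ 2))
        = C ^ n * Complex.exp (κ * ((∑ j, a j ^ 2 : ℝ) : ℂ)) := by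
      intro n a
      rw [Finset.prod_mul_distrib, ← Complex.exp_sum, ← Finset.mul_sum]
      simp
    have hR : ∫ w, Complex.exp (s * ((∑ j, (m j + w j) ^ 2 : ℝ) : ℂ) * Complex.I)
        ∂(stdGaussian (p + 2)) = C ^ (p + 2) * Complex.exp (κ * ((∑ j, m j ^ 2 : ℝ) : ℂ)) := by
      simp_rw [hprod]
      unfold _root_.stdGaussian
      rw [integral_fintype_prod_eq_prod
        (fun j (x : ℝ) => Complex.exp (s * ((m j + x) ^ 2 : ℝ) * Complex.I))]
      simp_rw [h1]
      exact hexp _ m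
    have hL : ∫ w, (μ i + w i) • Complex.exp (s * ((∑ j, (μ j + w j) ^ 2 : ℝ) : ℂ) * Complex.I)
        ∂(stdGaussian p) = μ i * C ^ 2 * (C ^ p * Complex.exp (κ * ((∑ j, μ j ^ 2 : ℝ) : ℂ))) := by
      have : ∀ w : Fin p → ℝ,
          (μ i + w i) • Complex.exp (s * ((∑ j, (μ j + w j) ^ 2 : ℝ) : ℂ) * Complex.I)
          = ∏ j, ((if j = i then ((μ j + w j : ℝ) : ℂ) else 1) *
            Complex.exp (s * ((μ j + w j) ^ 2 : ℝ) * Complex.I)) := by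
        intro w
        rw [Finset.prod_mul_distrib, hprod, Complex.real_smul]
        simp
      simp_rw [this]
      unfold _root_.stdGaussian
      rw [integral_fintype_prod_eq_prod
        (fun j (x : ℝ) => (if j = i then ((μ j + x : ℝ) : ℂ) else 1) *
            Complex.exp (s * ((μ j + x) ^ 2 : ℝ) * Complex.I))]
      have h3 : ∀ j, ∫ x : ℝ, (if j = i then ((μ j + x : ℝ) : ℂ) else 1) *
            Complex.exp (s * ((μ j + x) ^ 2 : ℝ) * Complex.I) ∂(gaussianReal 0 1)
          = (if j = i then μ j * C ^ 2 else 1) * (C * Complex.exp (κ * (μ j : ℂ) ^ 2)) := by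
        intro j
        by_cases hj : j = i
        · simp only [hj, if_true]; exact h2 _
        · simp only [hj, if_false, one_mul]; exact h1 _
      simp_rw [h3]
      rw [Finset.prod_mul_distrib, hexp]
      simp
    rw [hL, hR, hm, Complex.real_smul]
    ring
end

section
/- Let Z be a Gaussian random p-vector with mean μ and covariance I_p, and let φ : R → R be a bounded measurable function. Then E[φ(‖Z‖²) Z Z'] = E[φ(V)] I_p + E[φ(W)] μ μ', where V ~ χ²_{p+2}(‖μ‖²) and W ~ χ²_{p+4}(‖μ‖²). -/
open MeasureTheory ProbabilityTheory Matrix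

namespace S6
open Complex

noncomputable def J (t m : ℝ) (n : ℕ) : ℂ :=
  ∫ x, cexp (t * ((m + x : ℝ) : ℂ) ^ 2 * I) * ((m + x : ℝ) : ℂ) ^ n ∂(gaussianReal 0 1)

noncomputable def F (t m : ℝ) (x : ℝ) : ℂ :=
  ((√(2 * Real.pi))⁻¹ : ℝ) * cexp ((-(1/2) + t * I) * (x : ℂ) ^ 2 + m * x + (-(m : ℂ)^2/2))

lemma F_eq (t m x : ℝ) : F t m x = (gaussianPDFReal m 1 x : ℂ) * cexp (t * (x : ℂ) ^ 2 * I) := by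
  simp only [F, gaussianPDFReal, NNReal.coe_one, mul_one]
  push_cast
  rw [mul_assoc, ← Complex.exp_add]
  congr 2
  ring

lemma integrable_pow_gauss (m : ℝ) (n : ℕ) :
    Integrable (fun x : ℝ => (x : ℂ) ^ n) (gaussianReal m 1) := by
  have h := (memLp_id_gaussianReal' (μ := m) (v := 1) (n : ENNReal) (by simp)).integrable_norm_pow'
  refine h.mono' (by fun_prop) (ae_of_all _ fun x => ?_)
  simp

lemma J_eq (t m : ℝ) (n : ℕ) : J t m n = ∫ x : ℝ, F t m x * (x : ℂ) ^ n := by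
  have h1 : J t m n = ∫ x : ℝ, cexp (t * (x : ℂ) ^ 2 * I) * (x : ℂ) ^ n ∂(gaussianReal m 1) := by
    have := gaussianReal_map_const_add (μ := 0) (v := 1) m
    rw [zero_add] at this
    rw [← this, integral_map (by fun_prop) (by fun_prop)]
    rfl
  rw [h1, integral_gaussianReal_eq_integral_smul (by norm_num)]
  refine integral_congr_ae (ae_of_all _ fun x => ?_)
  simp only [F_eq, Complex.real_smul]
  ring

lemma F_int (t m : ℝ) (n : ℕ) : Integrable (fun x : ℝ => F t m x * (x : ℂ) ^ n) := by
  have h : Integrable (fun x : ℝ => cexp (t * (x : ℂ) ^ 2 * I) * (x : ℂ) ^ n) (gaussianReal m 1) := by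
    refine (integrable_pow_gauss m n).bdd_mul (c := 1) (by fun_prop) (ae_of_all _ fun x => ?_)
    have : cexp (t * (x : ℂ) ^ 2 * I) = cexp ((t * x ^ 2 : ℝ) * I) := by push_cast; rfl
    rw [this, Complex.norm_exp_ofReal_mul_I]
  rw [gaussianReal_of_var_ne_zero _ (by norm_num),
    integrable_withDensity_iff_integrable_smul' (measurable_gaussianPDF _ _)
      (ae_of_all _ fun _ ↦ gaussianPDF_lt_top)] at h
  refine h.congr (ae_of_all _ fun x => ?_)
  simp only [F_eq, Complex.real_smul, toReal_gaussianPDF]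
  ring

lemma F_deriv (t m x : ℝ) : HasDerivAt (F t m) (F t m x * ((-1 + 2 * t * I) * x + m)) x := by
  have h0 : HasDerivAt (fun x : ℝ => (x : ℂ)) 1 x := Complex.ofRealCLM.hasDerivAt
  have h := ((((h0.pow 2).const_mul (-(1/2 : ℂ) + t * I)).add (h0.const_mul (m : ℂ))).add_const
    (-(m : ℂ)^2/2)).cexp.const_mul (((√(2 * Real.pi))⁻¹ : ℝ) : ℂ)
  refine h.congr_deriv ?_
  simp only [F, Pi.add_apply, Pi.pow_apply]
  push_cast
  ring

lemma b_ne (t : ℝ) : (1 - 2 * t * I : ℂ) ≠ 0 := by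
  intro h
  have := congrArg Complex.re h
  simp at this

lemma J_one (t m : ℝ) : J t m 1 = m / (1 - 2 * t * I) * J t m 0 := by
  have h := integral_eq_zero_of_hasDerivAt_of_integrable (F_deriv t m) 
    (((F_int t m 1).const_mul (-1 + 2 * t * I)).add ((F_int t m 0).const_mul (m : ℂ)) |>.congr
      (ae_of_all _ fun x => by simp; ring)) (by simpa using F_int t m 0)
  have h2 : ∫ x : ℝ, F t m x * ((-1 + 2 * t * I) * x + m)
      = (-1 + 2 * t * I) * J t m 1 + m * J t m 0 := by
    rw [J_eq, J_eq, ← integral_const_mul, ← integral_const_mul,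
      ← integral_add ((F_int t m 1).const_mul _) ((F_int t m 0).const_mul _)]
    refine integral_congr_ae (ae_of_all _ fun x => ?_)
    simp; ring
  have := b_ne t
  rw [h2] at h
  field_simp
  linear_combination -h

lemma J_two (t m : ℝ) : J t m 2 =
    (1 / (1 - 2 * t * I) + (m / (1 - 2 * t * I)) ^ 2) * J t m 0 := by
  have hd : ∀ x : ℝ, HasDerivAt (fun x : ℝ => F t m x * (x : ℂ) ^ 1)
      (F t m x * ((-1 + 2 * t * I) * x ^ 2 + m * x + 1)) x := fun x => by
    have h0 : HasDerivAt (fun x : ℝ => (x : ℂ)) 1 x := Complex.ofRealCLM.hasDerivAt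
    simp only [pow_one]
    refine ((F_deriv t m x).mul h0).congr_deriv ?_
    ring
  have h := integral_eq_zero_of_hasDerivAt_of_integrable hd
    ((((F_int t m 2).const_mul (-1 + 2 * t * I)).add ((F_int t m 1).const_mul (m : ℂ))).add
      (F_int t m 0) |>.congr
      (ae_of_all _ fun x => by simp; ring)) (F_int t m 1)
  have h2 : ∫ x : ℝ, F t m x * ((-1 + 2 * t * I) * x ^ 2 + m * x + 1)
      = (-1 + 2 * t * I) * J t m 2 + m * J t m 1 + J t m 0 := by
    have hA : Integrable (fun x : ℝ => (-1 + 2 * t * I) * (F t m x * (x : ℂ) ^ 2)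
        + m * (F t m x * (x : ℂ) ^ 1)) :=
      ((F_int t m 2).const_mul _).add ((F_int t m 1).const_mul _)
    rw [J_eq, J_eq, J_eq, ← integral_const_mul, ← integral_const_mul,
      ← integral_add ((F_int t m 2).const_mul _) ((F_int t m 1).const_mul _),
      ← integral_add hA (F_int t m 0)]
    refine integral_congr_ae (ae_of_all _ fun x => ?_)
    simp; ring
  have := b_ne t
  rw [h2, J_one] at h
  field_simp at h ⊢
  linear_combination -h

lemma J_zero (t : ℝ) : ∃ K e : ℂ, K ^ 2 = 1 / (1 - 2 * t * I) ∧
    ∀ m : ℝ, J t m 0 = K * cexp (e * (m ^ 2 : ℝ)) := by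
  have hb := b_ne t
  have hb' : (-(1/2) + t * I : ℂ) ≠ 0 := fun h => hb (by linear_combination -2 * h)
  refine ⟨((√(2 * Real.pi))⁻¹ : ℝ) * (Real.pi / -(-(1/2) + t * I : ℂ)) ^ (1/2 : ℂ),
    -1/2 - 1 / (4 * (-(1/2) + t * I)), ?_, fun m => ?_⟩
  · rw [mul_pow, ← Complex.ofReal_pow, inv_pow, Real.sq_sqrt (by positivity)]
    rw [← Complex.cpow_ofNat_inv_pow (Real.pi / -(-(1/2) + t * I : ℂ)) 2] 
    rw [one_div]
    have hc : (-(-(1/2) + t * I) : ℂ) = (1 - 2 * t * I) / 2 := by ring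
    have hp : (Real.pi : ℂ) ≠ 0 := by exact_mod_cast Real.pi_ne_zero
    simp only [one_div, Complex.cpow_ofNat_inv_pow] at hc ⊢
    rw [hc]
    push_cast
    field_simp
  · rw [J_eq]
    simp only [pow_zero, mul_one, F]
    rw [integral_const_mul, integral_cexp_quadratic (by simp), mul_assoc]
    congr 3
    push_cast
    field_simp

noncomputable def q {p : ℕ} (m : Fin p → ℝ) (w : Fin p → ℝ) : ℝ := ∑ k, (m k + w k) ^ 2

lemma q_meas {p : ℕ} (m : Fin p → ℝ) : Measurable (q m) := by
  unfold q; fun_prop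

instance (p : ℕ) : IsProbabilityMeasure (stdGaussian p) := by
  unfold _root_.stdGaussian; infer_instance

lemma exp_q {p : ℕ} (t : ℝ) (m w : Fin p → ℝ) :
    cexp (t * (q m w : ℝ) * I) = ∏ k, cexp (t * ((m k + w k : ℝ) : ℂ) ^ 2 * I) := by
  rw [← Complex.exp_sum, q]
  push_cast
  rw [Finset.mul_sum, Finset.sum_mul]

lemma char0 {p : ℕ} (t : ℝ) (m : Fin p → ℝ) :
    ∫ w, cexp (t * (q m w : ℝ) * I) ∂(stdGaussian p) = ∏ k, J t (m k) 0 := by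
  unfold _root_.stdGaussian J
  rw [← integral_fintype_prod_eq_prod]
  simp only [exp_q, pow_zero, mul_one]

lemma char2 {p : ℕ} (t : ℝ) (m : Fin p → ℝ) (i j : Fin p) :
    ∫ w, cexp (t * (q m w : ℝ) * I) * (((m i + w i) * (m j + w j) : ℝ) : ℂ) ∂(stdGaussian p)
      = ∏ k, J t (m k) ((if k = i then 1 else 0) + (if k = j then 1 else 0)) := by
  unfold _root_.stdGaussian J
  rw [← integral_fintype_prod_eq_prod (f := fun k x => cexp (t * ((m k + x : ℝ) : ℂ) ^ 2 * I) *
    ((m k + x : ℝ) : ℂ) ^ ((if k = i then 1 else 0) + (if k = j then 1 else 0)))]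
  refine integral_congr_ae (ae_of_all _ fun w => ?_)
  simp only [exp_q, Finset.prod_mul_distrib, pow_add, pow_ite, pow_one, pow_zero,
    Finset.prod_ite_eq', Finset.mem_univ, if_true]
  push_cast
  rfl

lemma key {p : ℕ} (μ : Fin p → ℝ) 
    (mV : Fin (p + 2) → ℝ) (hmV : ∑ i, mV i ^ 2 = ∑ i, μ i ^ 2)
    (mW : Fin (p + 4) → ℝ) (hmW : ∑ i, mW i ^ 2 = ∑ i, μ i ^ 2) (t : ℝ) (i j : Fin p) :
    ∫ w, cexp (t * (q μ w : ℝ) * I) * (((μ i + w i) * (μ j + w j) : ℝ) : ℂ) ∂(stdGaussian p)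
    = (∫ w, cexp (t * (q mV w : ℝ) * I) ∂(stdGaussian (p + 2))) * (if i = j then 1 else 0)
      + (∫ w, cexp (t * (q mW w : ℝ) * I) ∂(stdGaussian (p + 4))) * (μ i * μ j) := by
  obtain ⟨K, e, hK, hJ⟩ := J_zero t
  have hprod : ∀ (r : ℕ) (m : Fin r → ℝ), ∏ k, J t (m k) 0
      = K ^ r * cexp (e * (∑ k, m k ^ 2 : ℝ)) := by
    intro r m
    simp only [hJ, Finset.prod_mul_distrib, ← Complex.exp_sum]
    simp [Finset.mul_sum]
  rw [char2, char0, char0, hprod, hprod, hmV, hmW]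
  set b : ℂ := 1 - 2 * t * I with hb
  have hJn : ∀ k, J t (μ k) ((if k = i then 1 else 0) + (if k = j then 1 else 0))
      = J t (μ k) 0 * (if k = i then (if i = j then 1 / b + (μ i / b) ^ 2 else μ i / b) else
        if k = j then μ j / b else 1) := by
    intro k
    by_cases h1 : k = i
    · subst h1
      by_cases h2 : k = j
      · subst h2
        simp only [if_true]
        rw [J_two]; ring
      · simp only [h2, if_true, if_false]
        rw [J_one]; ring
    · by_cases h2 : k = j
      · subst h2
        simp only [h1, if_true, if_false]
        rw [zero_add, J_one]; ring
      · simp [h1, h2]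
  simp only [hJn, Finset.prod_mul_distrib, hprod]
  have hK4 : K ^ 4 = (1 / b) ^ 2 := by rw [← hK]; ring
  by_cases hij : i = j
  · subst hij
    rw [Finset.prod_eq_single i (by intro k _ hk; simp [hk]) (by simp)]
    simp only [if_true]
    rw [pow_add, pow_add, hK, hK4]
    ring
  · rw [Finset.prod_eq_mul i j hij (by intro k _ hk; simp [hk.1, hk.2]) (by simp) (by simp)]
    simp only [hij, Ne.symm hij, if_true, if_false]
    rw [pow_add, pow_add, hK, hK4]
    ring

lemma memLp_coord {p : ℕ} (μ : Fin p → ℝ) (i : Fin p) :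
    MemLp (fun w : Fin p → ℝ => μ i + w i) 2 (stdGaussian p) := by
  have h : MemLp (fun w : Fin p → ℝ => w i) 2 (stdGaussian p) :=
    (memLp_id_gaussianReal' (μ := 0) (v := 1) 2 (by simp)).comp_measurePreserving
      (measurePreserving_eval (fun _ : Fin p => gaussianReal 0 1) i)
  exact (memLp_const (μ i)).add h

lemma int_coord {p : ℕ} (μ : Fin p → ℝ) (i j : Fin p) :
    Integrable (fun w : Fin p → ℝ => (μ i + w i) * (μ j + w j)) (stdGaussian p) :=
  (memLp_coord μ i).integrable_mul (memLp_coord μ j)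

lemma int_sq {p : ℕ} (μ : Fin p → ℝ) (i j : Fin p) :
    Integrable (fun w : Fin p → ℝ => ((μ i + w i) + (μ j + w j)) ^ 2) (stdGaussian p) :=
  ((memLp_coord μ i).add (memLp_coord μ j)).integrable_sq

/-- expansion of the square for bounded `f`. -/
lemma expand {𝕜 : Type*} [RCLike 𝕜] {p : ℕ} (μ : Fin p → ℝ) (i j : Fin p) (f : ℝ → 𝕜)
    (hf : StronglyMeasurable f) (C : ℝ) (hC : ∀ x, ‖f x‖ ≤ C) :
    ∫ w, (((μ i + w i) + (μ j + w j)) ^ 2) • f (q μ w) ∂(stdGaussian p)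
    = (∫ w, f (q μ w) * (((μ i + w i) * (μ i + w i) : ℝ) : 𝕜) ∂(stdGaussian p))
      + 2 * (∫ w, f (q μ w) * (((μ i + w i) * (μ j + w j) : ℝ) : 𝕜) ∂(stdGaussian p))
      + (∫ w, f (q μ w) * (((μ j + w j) * (μ j + w j) : ℝ) : 𝕜) ∂(stdGaussian p)) := by
  have hI : ∀ i j, Integrable (fun w : Fin p → ℝ =>
      f (q μ w) * (((μ i + w i) * (μ j + w j) : ℝ) : 𝕜)) (stdGaussian p) := fun i j =>
    (int_coord μ i j).ofReal.bdd_mul (c := C)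
      (hf.comp_measurable (q_meas μ)).aestronglyMeasurable (ae_of_all _ fun w => hC _)
  rw [← integral_const_mul, ← integral_add (hI i i) ((hI i j).const_mul 2),
    ← integral_add (show Integrable (fun w : Fin p → ℝ => 
      f (q μ w) * (((μ i + w i) * (μ i + w i) : ℝ) : 𝕜) +
      2 * (f (q μ w) * (((μ i + w i) * (μ j + w j) : ℝ) : 𝕜))) (stdGaussian p) from
      (hI i i).add ((hI i j).const_mul 2)) (hI j j)]
  refine integral_congr_ae (ae_of_all _ fun w => ?_)
  simp only [RCLike.real_smul_eq_coe_mul]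
  push_cast
  ring

noncomputable def nuL {p : ℕ} (μ : Fin p → ℝ) (i j : Fin p) : Measure ℝ :=
  ((stdGaussian p).withDensity
    (fun w => ENNReal.ofReal (((μ i + w i) + (μ j + w j)) ^ 2))).map (q μ)

noncomputable def nuR {r s : ℕ} (mV : Fin r → ℝ) (mW : Fin s → ℝ) (a b : NNReal) : Measure ℝ :=
  a • (stdGaussian r).map (q mV) + b • (stdGaussian s).map (q mW)

instance {p : ℕ} (μ : Fin p → ℝ) (i j : Fin p) : IsFiniteMeasure (nuL μ i j) := by
  unfold nuL
  have := isFiniteMeasure_withDensity_ofReal (int_sq μ i j).2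
  infer_instance

instance {r s : ℕ} (mV : Fin r → ℝ) (mW : Fin s → ℝ) (a b : NNReal) :
    IsFiniteMeasure (nuR mV mW a b) := by
  unfold nuR
  infer_instance

lemma int_nuL {𝕜 : Type*} [RCLike 𝕜] {p : ℕ} (μ : Fin p → ℝ) (i j : Fin p) (f : ℝ → 𝕜)
    (hf : StronglyMeasurable f) :
    ∫ x, f x ∂(nuL μ i j) =
      ∫ w, (((μ i + w i) + (μ j + w j)) ^ 2) • f (q μ w) ∂(stdGaussian p) := by
  unfold nuL
  rw [integral_map (q_meas μ).aemeasurable hf.aestronglyMeasurable,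
    integral_withDensity_eq_integral_toReal_smul (by fun_prop) (ae_of_all _ fun _ => by simp)]
  refine integral_congr_ae (ae_of_all _ fun w => ?_)
  simp only
  rw [ENNReal.toReal_ofReal (by positivity)]

lemma int_nuR {𝕜 : Type*} [RCLike 𝕜] {r s : ℕ} (mV : Fin r → ℝ) (mW : Fin s → ℝ) (a b : NNReal)
    (f : ℝ → 𝕜)
    (hf : StronglyMeasurable f) (C : ℝ) (hC : ∀ x, ‖f x‖ ≤ C) :
    ∫ x, f x ∂(nuR mV mW a b) =
      ((a : ℝ) : 𝕜) * ∫ w, f (q mV w) ∂(stdGaussian r)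
      + ((b : ℝ) : 𝕜) * ∫ w, f (q mW w) ∂(stdGaussian s) := by
  have hI : ∀ (ν : Measure ℝ) [IsFiniteMeasure ν], Integrable f ν := fun ν _ =>
    Integrable.of_bound hf.aestronglyMeasurable C (ae_of_all _ hC)
  unfold nuR
  rw [integral_add_measure (hI _) (hI _), integral_smul_nnreal_measure,
    integral_smul_nnreal_measure,
    integral_map (q_meas _).aemeasurable hf.aestronglyMeasurable,
    integral_map (q_meas _).aemeasurable hf.aestronglyMeasurable]
  simp only [NNReal.smul_def, RCLike.real_smul_eq_coe_mul]

lemma nu_eq {p : ℕ} (μ : Fin p → ℝ) 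
    (mV : Fin (p + 2) → ℝ) (hmV : ∑ i, mV i ^ 2 = ∑ i, μ i ^ 2)
    (mW : Fin (p + 4) → ℝ) (hmW : ∑ i, mW i ^ 2 = ∑ i, μ i ^ 2) (i j : Fin p) :
    nuL μ i j = nuR mV mW (2 + 2 * (if i = j then 1 else 0))
      (Real.toNNReal ((μ i + μ j) ^ 2)) := by
  apply Measure.ext_of_charFun
  ext t
  have hf : StronglyMeasurable (fun x : ℝ => cexp (t * x * I)) := by
    apply Continuous.stronglyMeasurable; fun_prop
  have hC : ∀ x : ℝ, ‖cexp (t * x * I)‖ ≤ 1 := fun x => by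
    rw [← Complex.ofReal_mul, Complex.norm_exp_ofReal_mul_I]
  rw [charFun_apply_real, charFun_apply_real, int_nuL _ _ _ _ hf, int_nuR _ _ _ _ _ hf 1 hC,
    expand _ _ _ _ hf 1 hC]
  have k := key μ mV hmV mW hmW t
  simp only [RCLike.ofReal_eq_complex_ofReal, Complex.coe_algebraMap] at *
  erw [k i i, k i j, k j j]
  rw [Real.coe_toNNReal _ (sq_nonneg _)]
  rw [if_pos (rfl : i = i), if_pos (rfl : j = j)]
  generalize (∫ w, cexp (t * (q mV w : ℝ) * I) ∂(stdGaussian (p + 2))) = A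
  generalize (∫ w, cexp (t * (q mW w : ℝ) * I) ∂(stdGaussian (p + 4))) = B
  by_cases h : i = j
  · simp [h]; ring
  · simp [h]; ring

lemma sq_id {p : ℕ} (μ : Fin p → ℝ) (φ : ℝ → ℝ)
    (hφm : Measurable φ) (C : ℝ) (hC : ∀ x, |φ x| ≤ C)
    (mV : Fin (p + 2) → ℝ) (hmV : ∑ i, mV i ^ 2 = ∑ i, μ i ^ 2)
    (mW : Fin (p + 4) → ℝ) (hmW : ∑ i, mW i ^ 2 = ∑ i, μ i ^ 2) (i j : Fin p) :
    (∫ w, φ (q μ w) * ((μ i + w i) * (μ i + w i)) ∂(stdGaussian p))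
      + 2 * (∫ w, φ (q μ w) * ((μ i + w i) * (μ j + w j)) ∂(stdGaussian p))
      + (∫ w, φ (q μ w) * ((μ j + w j) * (μ j + w j)) ∂(stdGaussian p))
    = (2 + 2 * (if i = j then 1 else 0)) * ∫ w, φ (q mV w) ∂(stdGaussian (p + 2))
      + (μ i + μ j) ^ 2 * ∫ w, φ (q mW w) ∂(stdGaussian (p + 4)) := by
  have hf := hφm.stronglyMeasurable
  have h1 := expand μ i j φ hf C hC
  have h2 := int_nuR mV mW (2 + 2 * (if i = j then 1 else 0))
      (Real.toNNReal ((μ i + μ j) ^ 2)) φ hf C hC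
  rw [← nu_eq μ mV hmV mW hmW, int_nuL _ _ _ _ hf, h1] at h2
  simp only [RCLike.ofReal_real_eq_id, id] at h2
  rw [h2]
  rw [Real.coe_toNNReal _ (sq_nonneg _)]
  split_ifs <;> simp

end S6

theorem stmt6 (p : ℕ) (μ : Fin p → ℝ) (φ : ℝ → ℝ)
    (hφm : Measurable φ) (hφb : ∃ Cb, ∀ x, |φ x| ≤ Cb)
    (mV : Fin (p + 2) → ℝ) (hmV : ∑ i, mV i ^ 2 = ∑ i, μ i ^ 2)
    (mW : Fin (p + 4) → ℝ) (hmW : ∑ i, mW i ^ 2 = ∑ i, μ i ^ 2) :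
    ∀ i j, ∫ w, φ (∑ k, (μ k + w k) ^ 2) * ((μ i + w i) * (μ j + w j)) ∂(stdGaussian p)
      = (∫ v, φ (∑ k, (mV k + v k) ^ 2) ∂(stdGaussian (p + 2)))
          * (1 : Matrix (Fin p) (Fin p) ℝ) i j
        + (∫ v, φ (∑ k, (mW k + v k) ^ 2) ∂(stdGaussian (p + 4))) * (μ i * μ j) := by
  intro i j
  obtain ⟨C, hC⟩ := hφb
  have h := S6.sq_id μ φ hφm C hC mV hmV mW hmW
  have hii := h i i
  have hjj := h j j
  have hij := h i j
  simp only [if_true] at hii hjj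
  rw [Matrix.one_apply]
  simp only [S6.q] at hii hjj hij
  split_ifs at hij ⊢ <;> linear_combination (1/2) * hij - (1/8) * hii - (1/8) * hjj
end

section
/- Let D be a Gaussian random p-vector with mean P μ₀ and covariance P, where P is a symmetric idempotent p×p matrix of rank p−r and μ₀ ∈ R^p. Let λ(v) := 1 if v ≤ c and 0 otherwise, for a fixed c > 0. Then E[λ(‖D‖²) D] = γ₂ P μ₀, where γ₂ := Pr[V₂ ≤ c] with V₂ ~ χ²_{p−r+2}(μ₀' P μ₀). -/
open MeasureTheory ProbabilityTheory Matrix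

instance instProbG (p : ℕ) : IsProbabilityMeasure (_root_.stdGaussian p) := by
  unfold _root_.stdGaussian; infer_instance

theorem map_mulVec_G {k p : ℕ} (A : Matrix (Fin k) (Fin p) ℝ) (hA : A * Aᵀ = 1) :
    (_root_.stdGaussian p).map (fun w => A *ᵥ w) = _root_.stdGaussian k := by
  have hmA : Measurable (fun w : Fin p → ℝ => A *ᵥ w) := by
    apply Continuous.measurable
    fun_prop
  have hm : Measurable (WithLp.toLp 2 : (Fin k → ℝ) → EuclideanSpace ℝ (Fin k)) := by fun_prop
  have key : ((_root_.stdGaussian p).map (fun w => A *ᵥ w)).map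
      (WithLp.toLp 2 : (Fin k → ℝ) → EuclideanSpace ℝ (Fin k))
      = (_root_.stdGaussian k).map (WithLp.toLp 2) := by
    have e2 : (_root_.stdGaussian k).map (WithLp.toLp 2)
      = ProbabilityTheory.stdGaussian (EuclideanSpace ℝ (Fin k)) := map_pi_eq_stdGaussian
    have e1 : (_root_.stdGaussian p).map (WithLp.toLp 2)
      = ProbabilityTheory.stdGaussian (EuclideanSpace ℝ (Fin p)) := map_pi_eq_stdGaussian
    have : IsProbabilityMeasure ((_root_.stdGaussian p).map (fun w => A *ᵥ w)) :=
      Measure.isProbabilityMeasure_map hmA.aemeasurable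
    have : IsProbabilityMeasure (((_root_.stdGaussian p).map (fun w => A *ᵥ w)).map
      (WithLp.toLp 2 : (Fin k → ℝ) → EuclideanSpace ℝ (Fin k))) :=
      Measure.isProbabilityMeasure_map hm.aemeasurable
    rw [e2]
    apply Measure.ext_of_charFun (E := EuclideanSpace ℝ (Fin k))
    ext t
    have h1 : charFun ((_root_.stdGaussian p).map (WithLp.toLp 2))
        (WithLp.toLp 2 (Aᵀ *ᵥ t.ofLp) : EuclideanSpace ℝ (Fin p)) = 
        Complex.exp (- ‖t‖ ^ 2 / 2) := by
      rw [e1, charFun_stdGaussian]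
      have : ‖(WithLp.toLp 2 (Aᵀ *ᵥ t.ofLp) : EuclideanSpace ℝ (Fin p))‖ ^ 2 = ‖t‖ ^ 2 := by
        rw [EuclideanSpace.real_norm_sq_eq, EuclideanSpace.real_norm_sq_eq]
        have h := dotProduct_mulVec (Aᵀ *ᵥ t.ofLp) Aᵀ t.ofLp
        rw [vecMul_transpose, mulVec_mulVec, hA, one_mulVec] at h
        simpa [dotProduct, pow_two] using h
      rw [← Complex.ofReal_pow, this, Complex.ofReal_pow]
    rw [charFun_stdGaussian, ← h1, charFun_apply, charFun_apply, Measure.map_map hm hmA,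
      integral_map (hm.comp hmA).aemeasurable (by fun_prop),
      integral_map (by fun_prop) (by fun_prop)]
    congr 1
    ext w
    congr 3
    simp only [Function.comp, EuclideanSpace.inner_eq_star_dotProduct, star_trivial]
    rw [dotProduct_mulVec, ← mulVec_transpose]
  have := congrArg (Measure.map (WithLp.ofLp : EuclideanSpace ℝ (Fin k) → (Fin k → ℝ))) key
  rw [Measure.map_map (by fun_prop) hm, Measure.map_map (by fun_prop) hm] at this
  have hid : ((WithLp.ofLp : EuclideanSpace ℝ (Fin k) → (Fin k → ℝ)) ∘ WithLp.toLp 2) = id := rfl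
  simpa [hid] using this

theorem exists_householder {n : ℕ} (m m' : Fin n → ℝ) (h : m ⬝ᵥ m = m' ⬝ᵥ m') :
    ∃ Q : Matrix (Fin n) (Fin n) ℝ, Q * Qᵀ = 1 ∧ Qᵀ * Q = 1 ∧ Q *ᵥ m = m' := by
  by_cases hu : (m - m') ⬝ᵥ (m - m') = 0
  · have : m - m' = 0 := dotProduct_self_eq_zero.1 hu
    exact ⟨1, by simp, by simp, by rw [one_mulVec]; exact sub_eq_zero.1 this⟩
  · set u := m - m' with hu'
    have hT : (1 - (2 / (u ⬝ᵥ u)) • vecMulVec u u)ᵀ = 1 - (2 / (u ⬝ᵥ u)) • vecMulVec u u := by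
      rw [transpose_sub, transpose_smul, transpose_vecMulVec, transpose_one]
    have hQ : (1 - (2 / (u ⬝ᵥ u)) • vecMulVec u u) * (1 - (2 / (u ⬝ᵥ u)) • vecMulVec u u) = 1 := by
      have : vecMulVec u u * vecMulVec u u = (u ⬝ᵥ u) • vecMulVec u u := by
        rw [vecMulVec_mul_vecMulVec]
        ext i j; simp [vecMulVec_apply]; try ring
      rw [sub_mul, mul_sub, mul_sub, smul_mul_smul_comm, this, smul_smul]
      simp only [one_mul, mul_one]
      have : 2 / (u ⬝ᵥ u) * (2 / (u ⬝ᵥ u)) * (u ⬝ᵥ u) = 2 / (u ⬝ᵥ u) + 2 / (u ⬝ᵥ u) := by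
        field_simp; norm_num
      rw [this, add_smul]; abel
    refine ⟨1 - (2 / (u ⬝ᵥ u)) • vecMulVec u u, by rw [hT, hQ], by rw [hT, hQ], ?_⟩
    have h2 : u ⬝ᵥ u = 2 * (u ⬝ᵥ m) := by
      simp only [hu', sub_dotProduct, dotProduct_sub, h, dotProduct_comm m' m]; 
      rw [← h]; ring
    rw [sub_mulVec, one_mulVec, smul_mulVec, vecMulVec_mulVec]
    have : m' = m - u := by simp [hu']
    rw [this]
    ext i
    simp
    rw [h2] at hu ⊢
    have hu2 : u ⬝ᵥ m ≠ 0 := fun h => hu (by rw [h, mul_zero])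
    field_simp

theorem exists_factor {p k : ℕ} (P : Matrix (Fin p) (Fin p) ℝ) (hsym : Pᵀ = P)
    (hidem : P * P = P) (hrank : P.rank = k) :
    ∃ B : Matrix (Fin k) (Fin p) ℝ, B * Bᵀ = 1 ∧ Bᵀ * B = P := by
  let L := toEuclideanLin P
  let S := LinearMap.range L
  have hk : Module.finrank ℝ S = k := by
    rw [← hrank, rank_eq_finrank_range_toLin P (EuclideanSpace.basisFun _ ℝ).toBasis (EuclideanSpace.basisFun _ ℝ).toBasis]
    rw [← toEuclideanLin_eq_toLin_orthonormal]
  let b : OrthonormalBasis (Fin k) ℝ S := (stdOrthonormalBasis ℝ S).reindex (finCongr hk)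
  let B : Matrix (Fin k) (Fin p) ℝ := fun i j => (b i : EuclideanSpace ℝ (Fin p)) j
  have hPL : ∀ x, (L x).ofLp = P *ᵥ x.ofLp := fun x => rfl
  have h1 : B * Bᵀ = 1 := by
    ext i j
    have := orthonormal_iff_ite.1 b.orthonormal j i
    rw [Submodule.coe_inner, EuclideanSpace.inner_eq_star_dotProduct] at this
    simp only [star_trivial] at this
    rw [Matrix.one_apply, mul_apply]
    simp only [eq_comm (a := i)]
    rw [← this]
    rfl
  have h2 : B * P = B := by
    ext i j
    obtain ⟨y, hy⟩ := (b i).2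
    have : P *ᵥ (b i : EuclideanSpace ℝ (Fin p)).ofLp = (b i : EuclideanSpace ℝ (Fin p)).ofLp := by
      rw [← hy, hPL, mulVec_mulVec, hidem]
    have := congrFun this j
    rw [← hsym]
    rw [mul_apply]
    simp only [transpose_apply]
    rw [mulVec, dotProduct] at this
    simp only [B]
    rw [← this]
    exact Finset.sum_congr rfl fun x _ => mul_comm _ _
  have h3 : Bᵀ * B * P = P := by
    apply Matrix.ext_of_mulVec_single
    intro j
    rw [Matrix.mul_assoc, ← mulVec_mulVec, ← mulVec_mulVec]
    generalize (Pi.single j (1:ℝ) : Fin p → ℝ) = w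
    have := b.sum_repr' ⟨L (WithLp.toLp 2 w), ⟨_, rfl⟩⟩
    have h := congrArg (fun x : S => (x : EuclideanSpace ℝ (Fin p)).ofLp) this
    simp only [hPL] at h
    conv_rhs => rw [← h]
    ext l
    simp only [Submodule.coe_sum, Submodule.coe_smul, Submodule.coe_inner,
      EuclideanSpace.inner_eq_star_dotProduct, hPL, star_trivial, WithLp.ofLp_sum, WithLp.ofLp_smul,
      Finset.sum_apply, Pi.smul_apply, smul_eq_mul]
    rw [mulVec, dotProduct]
    refine Finset.sum_congr rfl fun x _ => ?_
    rw [mul_comm, transpose_apply, dotProduct_comm]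
    rfl
  refine ⟨B, h1, ?_⟩
  rw [← h3, Matrix.mul_assoc, h2]

theorem hderiv_sq (z : ℝ) : HasDerivAt (fun z : ℝ => -z ^ 2 / 2) (-z) z :=
  ((hasDerivAt_pow 2 z).neg.div_const 2).congr_deriv (by simp; ring)

theorem one_dim (s R : ℝ) :
    ∫ z, (if (s + z) ^ 2 ≤ R then (1:ℝ) else 0) * z ∂(gaussianReal 0 1)
      = -s * ∫ z, (if (s + z) ^ 2 ≤ R then Real.exp (-(R - (s + z) ^ 2) / 2) else 0)
          ∂(gaussianReal 0 1) := by
  by_cases hR : R < 0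
  · have : ∀ z, ¬ (s + z) ^ 2 ≤ R := fun z => by have := sq_nonneg (s + z); linarith
    simp [this]
  push Not at hR
  obtain ⟨a, ha, rfl⟩ : ∃ a, 0 ≤ a ∧ R = a ^ 2 := ⟨√R, Real.sqrt_nonneg _, (Real.sq_sqrt hR).symm⟩
  have hset : ∀ z, (s + z) ^ 2 ≤ a ^ 2 ↔ z ∈ Set.Icc (-a - s) (a - s) := fun z => by
    rw [sq_le_sq, abs_of_nonneg ha, abs_le, Set.mem_Icc]
    constructor <;> rintro ⟨h1, h2⟩ <;> constructor <;> linarith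
  rw [integral_gaussianReal_eq_integral_smul (by norm_num),
    integral_gaussianReal_eq_integral_smul (by norm_num)]
  have e1 : ∀ z, gaussianPDFReal 0 1 z • ((if (s + z) ^ 2 ≤ a ^ 2 then (1:ℝ) else 0) * z)
      = (Set.Icc (-a - s) (a - s)).indicator (fun z => gaussianPDFReal 0 1 z * z) z := by
    intro z
    by_cases hz : (s + z) ^ 2 ≤ a ^ 2
    · simp only [hz, Set.indicator_of_mem ((hset z).1 hz)]; simp
    · simp only [hz, Set.indicator_of_notMem (fun h => hz ((hset z).2 h))]; simp
  have e2 : ∀ z, gaussianPDFReal 0 1 z • (if (s + z) ^ 2 ≤ a ^ 2 then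
        Real.exp (-(a ^ 2 - (s + z) ^ 2) / 2) else 0)
      = (Set.Icc (-a - s) (a - s)).indicator (fun z => gaussianPDFReal 0 1 z *
        Real.exp (-(a ^ 2 - (s + z) ^ 2) / 2)) z := by
    intro z
    by_cases hz : (s + z) ^ 2 ≤ a ^ 2
    · simp only [hz, Set.indicator_of_mem ((hset z).1 hz)]; simp
    · simp only [hz, Set.indicator_of_notMem (fun h => hz ((hset z).2 h))]; simp
  simp_rw [e1, e2]
  rw [integral_indicator measurableSet_Icc, integral_indicator measurableSet_Icc,
    integral_Icc_eq_integral_Ioc, integral_Icc_eq_integral_Ioc,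
    ← intervalIntegral.integral_of_le (by linarith), ← intervalIntegral.integral_of_le (by linarith),
    ← intervalIntegral.integral_const_mul, ← sub_eq_zero]
  have hpdf : ∀ z, gaussianPDFReal 0 1 z = (√(2 * Real.pi))⁻¹ * Real.exp (-z ^ 2 / 2) := by
    intro z; simp [gaussianPDFReal]
  simp_rw [hpdf]
  rw [← intervalIntegral.integral_sub (Continuous.intervalIntegrable (by fun_prop) _ _)
    (Continuous.intervalIntegrable (by fun_prop) _ _)]
  rw [intervalIntegral.integral_eq_sub_of_hasDerivAt (f := fun z => (√(2 * Real.pi))⁻¹ *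
    (- Real.exp (-z ^ 2 / 2) + Real.exp (-a ^ 2 / 2 + s ^ 2 / 2 + s * z)))]
  · have h1 : -(a - s) ^ 2 / 2 = -a ^ 2 / 2 + s ^ 2 / 2 + s * (a - s) := by ring
    have h2 : -(-a - s) ^ 2 / 2 = -a ^ 2 / 2 + s ^ 2 / 2 + s * (-a - s) := by ring
    simp only [h1, h2]; ring
  · intro z _
    have hd1 := hderiv_sq z
    have hd2 : HasDerivAt (fun z : ℝ => -a ^ 2 / 2 + s ^ 2 / 2 + s * z) s z := by
      simpa using ((hasDerivAt_id z).const_mul s).const_add (-a ^ 2 / 2 + s ^ 2 / 2)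
    refine (((hd1.exp.neg).add hd2.exp).const_mul ((√(2 * Real.pi))⁻¹)).congr_deriv ?_
    have h3 : Real.exp (-a ^ 2 / 2 + s ^ 2 / 2 + s * z) =
      Real.exp (-z ^ 2 / 2) * Real.exp (-(a ^ 2 - (s + z) ^ 2) / 2) := by
      rw [← Real.exp_add]; congr 1; ring
    rw [h3]; ring
  · exact Continuous.intervalIntegrable (by fun_prop) _ _

theorem two_dim (t : ℝ) :
    ∫ y, ∫ x, (if x ^ 2 + y ^ 2 ≤ t then (1:ℝ) else 0) ∂(gaussianReal 0 1) ∂(gaussianReal 0 1)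
      = if 0 ≤ t then 1 - Real.exp (- t / 2) else 0 := by
  by_cases ht : 0 ≤ t
  swap
  · have : ∀ x y : ℝ, ¬ x ^ 2 + y ^ 2 ≤ t := fun x y => by
      have := sq_nonneg x; have := sq_nonneg y; intro h; exact ht (by linarith)
    simp [this, ht]
  rw [if_pos ht]
  obtain ⟨a, ha, rfl⟩ : ∃ a, 0 ≤ a ∧ t = a ^ 2 := ⟨√t, Real.sqrt_nonneg _, (Real.sq_sqrt ht).symm⟩
  have hpdf : ∀ z, gaussianPDFReal 0 1 z = (√(2 * Real.pi))⁻¹ * Real.exp (-z ^ 2 / 2) := by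
    intro z; simp [gaussianPDFReal]
  have hpp : ∀ x y, gaussianPDFReal 0 1 x * gaussianPDFReal 0 1 y
      = (2 * Real.pi)⁻¹ * Real.exp (-(x ^ 2 + y ^ 2) / 2) := by
    intro x y
    rw [hpdf, hpdf, mul_mul_mul_comm, ← Real.exp_add, ← mul_inv,
      Real.mul_self_sqrt (by positivity)]
    congr 2; ring
  let F : ℝ × ℝ → ℝ := fun q => (if q.1 ^ 2 + q.2 ^ 2 ≤ a ^ 2 then (1:ℝ) else 0) *
    ((2 * Real.pi)⁻¹ * Real.exp (-(q.1 ^ 2 + q.2 ^ 2) / 2))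
  have hFi : Integrable F (volume.prod volume) := by
    have h0 : Integrable (fun q : ℝ × ℝ => gaussianPDFReal 0 1 q.1 * gaussianPDFReal 0 1 q.2)
      (volume.prod volume) := (integrable_gaussianPDFReal 0 1).mul_prod
        (integrable_gaussianPDFReal 0 1)
    refine h0.mono' ?_ (Filter.Eventually.of_forall fun q => ?_)
    · refine (Measurable.mul (Measurable.ite ?_ (by fun_prop) (by fun_prop))
        (by fun_prop)).aestronglyMeasurable
      exact measurableSet_le (by fun_prop) (by fun_prop)
    · rw [hpp, Real.norm_eq_abs, abs_mul, abs_of_pos (a := (2 * Real.pi)⁻¹ * _) (by positivity)]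
      split_ifs <;> simp
      positivity
  have hL : ∫ y, ∫ x, (if x ^ 2 + y ^ 2 ≤ a ^ 2 then (1:ℝ) else 0) ∂(gaussianReal 0 1)
      ∂(gaussianReal 0 1) = ∫ q, F q := by
    rw [Measure.volume_eq_prod, integral_prod_symm _ hFi,
      integral_gaussianReal_eq_integral_smul (by norm_num)]
    congr 1; ext y
    rw [integral_gaussianReal_eq_integral_smul (by norm_num), smul_eq_mul, ← integral_const_mul]
    congr 1; ext x
    simp only [F, smul_eq_mul]
    rw [← hpp]; ring
  rw [hL, ← integral_comp_polarCoord_symm]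
  have hG : ∀ q : ℝ × ℝ, q ∈ polarCoord.target → q.1 • F (polarCoord.symm q)
      = ((Set.Ioc 0 a).indicator (fun r => r * Real.exp (-r ^ 2 / 2)) q.1) * (2 * Real.pi)⁻¹ := by
    intro q hq
    have hq1 : 0 < q.1 := by
      simp [polarCoord] at hq; exact hq.1
    have hs : (q.1 * Real.cos q.2) ^ 2 + (q.1 * Real.sin q.2) ^ 2 = q.1 ^ 2 := by
      have := Real.cos_sq_add_sin_sq q.2
      linear_combination q.1 ^ 2 * this
    simp only [F, polarCoord_symm_apply, hs]
    by_cases h : q.1 ≤ a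
    · rw [Set.indicator_of_mem (Set.mem_Ioc.2 ⟨hq1, h⟩), if_pos (by gcongr), smul_eq_mul]; ring
    · rw [Set.indicator_of_notMem (fun h' => h h'.2), if_neg]
      · simp
      · intro h'; exact h ((sq_le_sq₀ hq1.le ha).1 h')
  rw [setIntegral_congr_fun polarCoord.open_target.measurableSet hG, polarCoord_target,
    Measure.volume_eq_prod, setIntegral_prod_mul (μ := volume) (ν := volume)
      (fun r => (Set.Ioc 0 a).indicator (fun r => r * Real.exp (-r ^ 2 / 2)) r)
      (fun _ => (2 * Real.pi)⁻¹)]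
  rw [setIntegral_indicator measurableSet_Ioc]
  have : Set.Ioi 0 ∩ Set.Ioc 0 a = Set.Ioc 0 a := by
    ext x; simp
  rw [this, ← intervalIntegral.integral_of_le ha]
  rw [intervalIntegral.integral_eq_sub_of_hasDerivAt (f := fun z => - Real.exp (-z ^ 2 / 2))]
  · have hpi := Real.pi_pos
    simp
    field_simp
    rw [max_eq_left (by positivity)]
    try ring
  · intro z _
    have hd1 := hderiv_sq z
    exact hd1.exp.neg.congr_deriv (by ring)
  · exact Continuous.intervalIntegrable (by fun_prop) _ _

theorem split_G {n : ℕ} (i : Fin (n + 1)) (f : (Fin (n + 1) → ℝ) → ℝ)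
    (hf : Integrable f (_root_.stdGaussian (n + 1))) :
    (∫ w, f w ∂(_root_.stdGaussian (n + 1))
      = ∫ z, ∫ x, f (i.insertNth x z) ∂(gaussianReal 0 1) ∂(_root_.stdGaussian n)) ∧
    Integrable (fun z => ∫ x, f (i.insertNth x z) ∂(gaussianReal 0 1)) (_root_.stdGaussian n) := by
  have hmp := (measurePreserving_piFinSuccAbove (fun _ : Fin (n + 1) => gaussianReal 0 1) i).symm
  have hi : Integrable (fun q : ℝ × (Fin n → ℝ) => f (i.insertNth q.1 q.2))
      ((gaussianReal 0 1).prod (_root_.stdGaussian n)) :=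
    (hmp.integrable_comp_emb (MeasurableEquiv.measurableEmbedding _)).2 hf
  have h2 : ∫ w, f w ∂(_root_.stdGaussian (n + 1)) =
      ∫ q : ℝ × (Fin n → ℝ), f (i.insertNth q.1 q.2)
        ∂((gaussianReal 0 1).prod (_root_.stdGaussian n)) :=
    (hmp.integral_comp' f).symm
  refine ⟨?_, hi.integral_prod_right⟩
  rw [h2, integral_prod_symm _ hi]

theorem meas_set {n : ℕ} (ν : Fin n → ℝ) (c : ℝ) :
    MeasurableSet {z : Fin n → ℝ | ∑ j, (ν j + z j) ^ 2 ≤ c} :=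
  measurableSet_le (by fun_prop) (by fun_prop)

theorem int_ind {n : ℕ} (ν : Fin n → ℝ) (c : ℝ) :
    Integrable (fun z => if ∑ j, (ν j + z j) ^ 2 ≤ c then (1:ℝ) else 0)
      (_root_.stdGaussian n) := by
  refine (integrable_const (1:ℝ)).mono' (Measurable.ite (meas_set ν c) (by fun_prop)
    (by fun_prop)).aestronglyMeasurable (Filter.Eventually.of_forall fun q => ?_)
  split_ifs <;> simp

theorem int_exp {n : ℕ} (ν : Fin n → ℝ) (c : ℝ) :
    Integrable (fun z => if ∑ j, (ν j + z j) ^ 2 ≤ c then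
      Real.exp (-(c - ∑ j, (ν j + z j) ^ 2) / 2) else 0) (_root_.stdGaussian n) := by
  refine (integrable_const (1:ℝ)).mono' (Measurable.ite (meas_set ν c) (by fun_prop)
    (by fun_prop)).aestronglyMeasurable (Filter.Eventually.of_forall fun q => ?_)
  split_ifs with h
  · rw [Real.norm_eq_abs, Real.abs_exp, Real.exp_le_one_iff]; linarith
  · simp

theorem int_coord {n : ℕ} (ν : Fin n → ℝ) (c : ℝ) (i : Fin n) :
    Integrable (fun z => (if ∑ j, (ν j + z j) ^ 2 ≤ c then (1:ℝ) else 0) * z i)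
      (_root_.stdGaussian n) := by
  have h0 : Integrable (fun z : Fin n → ℝ => z i) (_root_.stdGaussian n) :=
    integrable_eval (i := i) (μ := fun _ : Fin n => gaussianReal 0 1) IsGaussian.integrable_id
  refine h0.norm.mono' ((Measurable.ite (meas_set ν c) (by fun_prop)
    (by fun_prop)).mul (by fun_prop)).aestronglyMeasurable (Filter.Eventually.of_forall fun q => ?_)
  split_ifs <;> simp

theorem stein_ball {k : ℕ} (ν : Fin k → ℝ) (c : ℝ) (i : Fin k) :
    ∫ z, (if ∑ j, (ν j + z j) ^ 2 ≤ c then (1:ℝ) else 0) * z i ∂(_root_.stdGaussian k)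
      = -ν i * ∫ z, (if ∑ j, (ν j + z j) ^ 2 ≤ c then
          Real.exp (-(c - ∑ j, (ν j + z j) ^ 2) / 2) else 0) ∂(_root_.stdGaussian k) := by
  cases k with
  | zero => exact i.elim0
  | succ n =>
    rw [(split_G i _ (int_coord ν c i)).1, (split_G i _ (int_exp ν c)).1, ← integral_const_mul]
    congr 1; ext z
    have hs : ∀ x : ℝ, ∑ j, (ν j + (i.insertNth x z : Fin (n + 1) → ℝ) j) ^ 2
        = (ν i + x) ^ 2 + ∑ j, (ν (i.succAbove j) + z j) ^ 2 := by
      intro x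
      rw [Fin.sum_univ_succAbove _ i]
      simp
    have h := one_dim (ν i) (c - ∑ j, (ν (i.succAbove j) + z j) ^ 2)
    simp only [le_sub_iff_add_le, sub_sub, add_comm (∑ j, (ν (i.succAbove j) + z j) ^ 2)] at h
    simp only [hs, Fin.insertNth_apply_same]
    exact h

theorem gamma_two {k : ℕ} (ν : Fin k → ℝ) (c : ℝ) (m : Fin (k + 2) → ℝ)
    (hm : m ⬝ᵥ m = ν ⬝ᵥ ν) :
    ((_root_.stdGaussian (k + 2)) {v | ∑ j, (m j + v j) ^ 2 ≤ c}).toReal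
      = ∫ z, (if ∑ j, (ν j + z j) ^ 2 ≤ c then (1:ℝ) else 0) ∂(_root_.stdGaussian k)
        - ∫ z, (if ∑ j, (ν j + z j) ^ 2 ≤ c then
          Real.exp (-(c - ∑ j, (ν j + z j) ^ 2) / 2) else 0) ∂(_root_.stdGaussian k) := by
  let m' : Fin (k + 2) → ℝ := Fin.cons 0 (Fin.cons 0 ν)
  have hm' : m ⬝ᵥ m = m' ⬝ᵥ m' := by
    rw [hm]; simp [m', dotProduct, Fin.sum_univ_succ]
  obtain ⟨Q, hQ1, hQ2, hQm⟩ := exists_householder m m' hm'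
  have hset : {v : Fin (k + 2) → ℝ | ∑ j, (m j + v j) ^ 2 ≤ c}
      = (fun w => Q *ᵥ w) ⁻¹' {v | ∑ j, (m' j + v j) ^ 2 ≤ c} := by
    ext v
    simp only [Set.mem_setOf_eq, Set.mem_preimage]
    have h := dotProduct_mulVec (Q *ᵥ (m + v)) Q (m + v)
    rw [← mulVec_transpose, mulVec_mulVec, hQ2, one_mulVec, mulVec_add, hQm] at h
    have h' : ∑ j, (m' j + (Q *ᵥ v) j) ^ 2 = ∑ j, (m j + v j) ^ 2 := by
      simpa [dotProduct, pow_two] using h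
    rw [h']
  have hmQ : Measurable (fun w : Fin (k + 2) → ℝ => Q *ᵥ w) := by
    apply Continuous.measurable
    fun_prop
  rw [hset, ← Measure.map_apply hmQ (meas_set m' c), map_mulVec_G Q hQ1]
  have h1 : ((_root_.stdGaussian (k + 2)) {v | ∑ j, (m' j + v j) ^ 2 ≤ c}).toReal
      = ∫ v, (if ∑ j, (m' j + v j) ^ 2 ≤ c then (1:ℝ) else 0) ∂(_root_.stdGaussian (k + 2)) := by
    have := integral_indicator_one (μ := _root_.stdGaussian (k + 2)) (meas_set m' c)
    rw [Measure.real] at this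
    rw [← this]
    congr 1
  obtain ⟨h2, h3⟩ := split_G 0 _ (int_ind m' c)
  rw [h1, h2, (split_G 0 _ h3).1, ← integral_sub (int_ind ν c) (int_exp ν c)]
  congr 1; ext z
  have hs : ∀ x y : ℝ, ∑ j, (m' j + (Fin.insertNth (α := fun _ => ℝ) 0 x
      (Fin.insertNth (α := fun _ => ℝ) 0 y z)) j) ^ 2 = x ^ 2 + y ^ 2 + ∑ j, (ν j + z j) ^ 2 := by
    intro x y
    simp [m', Fin.sum_univ_succ]
    ring
  have h := two_dim (c - ∑ j, (ν j + z j) ^ 2)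
  simp only [le_sub_iff_add_le, zero_add] at h
  simp only [hs]
  rw [h]
  split_ifs <;> simp

theorem stmt8 (p r : ℕ) (hr : r ≤ p)
    (P : Matrix (Fin p) (Fin p) ℝ) (hsym : Pᵀ = P) (hidem : P * P = P)
    (hrank : P.rank = p - r)
    (μ₀ : Fin p → ℝ) (c : ℝ) (hc : 0 < c)
    (m : Fin (p - r + 2) → ℝ) (hm : ∑ i, m i ^ 2 = μ₀ ⬝ᵥ P.mulVec μ₀) :
    ∀ i, ∫ w, (if ∑ j, (P.mulVec μ₀ j + P.mulVec w j) ^ 2 ≤ c then (1 : ℝ) else 0)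
            * (P.mulVec μ₀ i + P.mulVec w i) ∂(stdGaussian p)
      = ((stdGaussian (p - r + 2)) {v | ∑ j, (m j + v j) ^ 2 ≤ c}).toReal
          * P.mulVec μ₀ i := by
  intro i
  obtain ⟨B, hB1, hB2⟩ := exists_factor P hsym hidem hrank
  generalize p - r = k at *
  have hP : ∀ w, P *ᵥ w = Bᵀ *ᵥ (B *ᵥ w) := fun w => by rw [mulVec_mulVec, hB2]
  set ν : Fin k → ℝ := B *ᵥ μ₀ with hν
  have hmν : m ⬝ᵥ m = ν ⬝ᵥ ν := by
    have h : m ⬝ᵥ m = μ₀ ⬝ᵥ P *ᵥ μ₀ := by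
      rw [← hm]; simp [dotProduct, pow_two]
    rw [h, hP, dotProduct_mulVec, vecMul_transpose]
  have hsq : ∀ w, ∑ j, ((P *ᵥ μ₀) j + (P *ᵥ w) j) ^ 2 = ∑ j, (ν j + (B *ᵥ w) j) ^ 2 := by
    intro w
    have h := dotProduct_mulVec (Bᵀ *ᵥ (ν + B *ᵥ w)) Bᵀ (ν + B *ᵥ w)
    rw [vecMul_transpose, mulVec_mulVec, hB1, one_mulVec, mulVec_add, ← hP, hν, ← hP] at h
    simpa [dotProduct, pow_two] using h
  have hmB : Measurable (fun w : Fin p → ℝ => B *ᵥ w) := by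
    apply Continuous.measurable
    fun_prop
  let f : (Fin k → ℝ) → ℝ := fun z => ∑ l, Bᵀ i l *
    (ν l * (if ∑ j, (ν j + z j) ^ 2 ≤ c then (1:ℝ) else 0) +
      (if ∑ j, (ν j + z j) ^ 2 ≤ c then (1:ℝ) else 0) * z l)
  have hf : ∀ l : Fin k, Integrable (fun z => Bᵀ i l *
    (ν l * (if ∑ j, (ν j + z j) ^ 2 ≤ c then (1:ℝ) else 0) +
      (if ∑ j, (ν j + z j) ^ 2 ≤ c then (1:ℝ) else 0) * z l)) (_root_.stdGaussian k) := fun l =>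
    (((int_ind ν c).const_mul _).add (int_coord ν c l)).const_mul _
  have hfi : Integrable f (_root_.stdGaussian k) := integrable_finsetSum _ fun l _ => hf l
  have h1 : ∀ w, (if ∑ j, ((P *ᵥ μ₀) j + (P *ᵥ w) j) ^ 2 ≤ c then (1 : ℝ) else 0)
            * ((P *ᵥ μ₀) i + (P *ᵥ w) i) = f (B *ᵥ w) := by
    intro w
    rw [hsq, hP, hP]
    simp only [f]
    rw [← hν, ← Pi.add_apply, ← mulVec_add, mulVec, dotProduct, Finset.mul_sum]
    refine Finset.sum_congr rfl fun l _ => ?_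
    rw [Pi.add_apply]; ring
  simp_rw [h1]
  have hfm : AEStronglyMeasurable f ((_root_.stdGaussian p).map (fun w => B *ᵥ w)) := by
    rw [map_mulVec_G B hB1]; exact hfi.1
  rw [← integral_map hmB.aemeasurable hfm, map_mulVec_G B hB1, integral_finsetSum _ fun l _ => hf l,
    gamma_two ν c m hmν, hP, ← hν, mulVec, dotProduct, Finset.mul_sum]
  refine Finset.sum_congr rfl fun l _ => ?_
  rw [integral_const_mul, integral_add ((int_ind ν c).const_mul _) (int_coord ν c l),
    integral_const_mul, stein_ball]
  ring
end

section
/- Let D be a Gaussian random p-vector with mean P μ₀ and covariance P, where P is a symmetric idempotent p×p matrix of rank p−r. Let λ(v) := 1 if v ≤ c and 0 otherwise. Then E[λ(‖D‖²) D D'] = γ₂ P + γ₄ P μ₀ μ₀' P, where γ_j := Pr[V_j ≤ c] with V_j ~ χ²_{p−r+j}(μ₀' P μ₀). -/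
open MeasureTheory ProbabilityTheory Matrix

lemma aux_gauss_s9 (s : ℝ) (hs : 0 ≤ s) (θ : ℝ) (f : ℝ → ℝ) (τ : NNReal) (hτ : (τ:ℝ) = 1 / (1 + 2 * s)) :
    ∫ x, Real.exp (-(s * (θ + x) ^ 2)) * f (θ + x) ∂(gaussianReal 0 1)
      = (√(τ:ℝ) * Real.exp (-(s * τ * θ ^ 2))) * ∫ x, f x ∂(gaussianReal (θ * τ) τ) := by
  have hpos : (0:ℝ) < 1 + 2 * s := by linarith
  have hτpos : (0:ℝ) < τ := by rw [hτ]; positivity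
  have hτ0 : τ ≠ 0 := by
    intro h; rw [h] at hτpos; simp at hτpos
  have h1 : ∫ x, Real.exp (-(s * (θ + x) ^ 2)) * f (θ + x) ∂(gaussianReal 0 1)
      = ∫ x, Real.exp (-(s * x ^ 2)) * f x ∂(gaussianReal θ 1) := by
    have := gaussianReal_map_const_add (μ := 0) (v := 1) θ
    rw [zero_add] at this
    rw [← this, (measurableEmbedding_addLeft θ).integral_map]
  rw [h1, integral_gaussianReal_eq_integral_smul one_ne_zero,
    integral_gaussianReal_eq_integral_smul hτ0, ← integral_const_mul]
  congr 1
  ext x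
  simp only [gaussianPDFReal, smul_eq_mul, NNReal.coe_one, mul_one]
  have e1 : √(2 * Real.pi * τ) = √(2 * Real.pi) * √(τ:ℝ) := Real.sqrt_mul (by positivity) _
  have e2 : √(τ:ℝ) ≠ 0 := (Real.sqrt_pos.2 hτpos).ne'
  have e3 : √(2 * Real.pi) ≠ 0 := (Real.sqrt_pos.2 (by positivity)).ne'
  have e4 : Real.exp (-(x - θ) ^ 2 / 2) * Real.exp (-(s * x ^ 2))
      = Real.exp (-(s * τ * θ ^ 2)) * Real.exp (-(x - θ * τ) ^ 2 / (2 * τ)) := by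
    rw [← Real.exp_add, ← Real.exp_add, hτ]
    congr 1
    field_simp
    ring
  rw [e1]
  calc _ = (√(2 * Real.pi))⁻¹ * (Real.exp (-(x - θ) ^ 2 / 2) * Real.exp (-(s * x ^ 2))) * f x := by ring
    _ = _ := by rw [e4]; field_simp

lemma aux_sq (m : ℝ) (τ : NNReal) : ∫ x, x ^ 2 ∂(gaussianReal m τ) = τ + m ^ 2 := by
  have h := variance_eq_sub (memLp_id_gaussianReal (μ := m) (v := τ) 2)
  rw [variance_id_gaussianReal] at h
  simp at h
  linarith

lemma aux_memLp {ι : Type*} [Fintype ι] (θ : ι → ℝ) (k : ι) :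
    MemLp (fun x : ι → ℝ => θ k + x k) 2 (Measure.pi (fun _ : ι => gaussianReal 0 1)) := by
  refine (memLp_const (θ k)).add ?_
  exact (memLp_id_gaussianReal (μ := 0) (v := 1) 2).comp_measurePreserving
    (measurePreserving_eval (fun _ : ι => gaussianReal 0 1) k)

lemma aux_mgf0 {ι : Type*} [Fintype ι] (s : ℝ) (hs : 0 ≤ s) (e θ : ι → ℝ)
    (he : ∀ k, e k = 0 ∨ e k = 1) :
    ∫ x, Real.exp (-(s * ∑ k, e k * (θ k + x k) ^ 2)) ∂(Measure.pi (fun _ : ι => gaussianReal 0 1))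
      = ∏ k, (if e k = 0 then 1 else √(1 / (1 + 2 * s)) * Real.exp (-(s * (1 / (1 + 2 * s)) * θ k ^ 2))) := by
  have : ∀ x : ι → ℝ, Real.exp (-(s * ∑ k, e k * (θ k + x k) ^ 2))
      = ∏ k, Real.exp (-(s * (e k * (θ k + x k) ^ 2))) := by
    intro x; rw [← Real.exp_sum, Finset.sum_neg_distrib, Finset.mul_sum]
  simp_rw [this]
  rw [integral_fintype_prod_eq_prod (fun k (x:ℝ) => Real.exp (-(s * (e k * (θ k + x) ^ 2))))]
  refine Finset.prod_congr rfl fun k _ => ?_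
  rcases he k with h | h
  · simp [h]
  · have hpos : (0:ℝ) ≤ 1 / (1 + 2 * s) := by positivity
    obtain ⟨τ, hτ⟩ : ∃ τ : NNReal, (τ : ℝ) = 1 / (1 + 2 * s) := ⟨⟨_, hpos⟩, rfl⟩
    have := aux_gauss_s9 s hs (θ k) (fun _ => 1) τ hτ
    rw [← hτ]
    simp [h] at this ⊢
    exact this

lemma aux_mgf2 {ι : Type*} [Fintype ι] [DecidableEq ι] (s : ℝ) (hs : 0 ≤ s) (e θ : ι → ℝ)
    (he : ∀ k, e k = 0 ∨ e k = 1) (i j : ι) (hi : e i = 1) (hj : e j = 1) :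
    ∫ x, Real.exp (-(s * ∑ k, e k * (θ k + x k) ^ 2)) * ((θ i + x i) * (θ j + x j))
        ∂(Measure.pi (fun _ : ι => gaussianReal 0 1))
      = (∏ k, (if e k = 0 then 1 else √(1 / (1 + 2 * s)) * Real.exp (-(s * (1 / (1 + 2 * s)) * θ k ^ 2))))
        * ((if i = j then 1 / (1 + 2 * s) else 0) + (θ i * (1 / (1 + 2 * s))) * (θ j * (1 / (1 + 2 * s)))) := by
  have hpos : (0:ℝ) ≤ 1 / (1 + 2 * s) := by positivity
  set τ : NNReal := ⟨1 / (1 + 2 * s), hpos⟩ with hτ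
  have hτ' : 1 / (1 + 2 * s) = (τ : ℝ) := rfl
  simp only [hτ']
  have : ∀ x : ι → ℝ, Real.exp (-(s * ∑ k, e k * (θ k + x k) ^ 2)) * ((θ i + x i) * (θ j + x j))
      = ∏ k, Real.exp (-(s * (e k * (θ k + x k) ^ 2))) *
        ((if k = i then (θ k + x k) else 1) * (if k = j then (θ k + x k) else 1)) := by
    intro x
    rw [Finset.prod_mul_distrib, Finset.prod_mul_distrib, ← Real.exp_sum, Finset.sum_neg_distrib, Finset.mul_sum]
    simp
  simp_rw [this]
  rw [integral_fintype_prod_eq_prod (fun k (x:ℝ) => Real.exp (-(s * (e k * (θ k + x) ^ 2))) *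
        ((if k = i then (θ k + x) else 1) * (if k = j then (θ k + x) else 1)))]
  have hG := fun k f => aux_gauss_s9 s hs (θ k) f τ rfl
  have h0 : ∀ k, ∫ x, Real.exp (-(s * (e k * (θ k + x) ^ 2))) ∂(gaussianReal 0 1) =
      if e k = 0 then 1 else √(τ:ℝ) * Real.exp (-(s * τ * θ k ^ 2)) := by
    intro k
    rcases he k with h | h
    · simp [h]
    · have := hG k (fun _ => 1)
      simp [h] at this ⊢
      exact this
  have h1 : ∀ k, e k = 1 → ∫ x, Real.exp (-(s * (e k * (θ k + x) ^ 2))) * (θ k + x) ∂(gaussianReal 0 1) =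
      (if e k = 0 then 1 else √(τ:ℝ) * Real.exp (-(s * τ * θ k ^ 2))) * (θ k * τ) := by
    intro k h
    have := hG k (fun x => x)
    simp [h] at this ⊢
    exact this
  have h2 : ∀ k, e k = 1 → ∫ x, Real.exp (-(s * (e k * (θ k + x) ^ 2))) * ((θ k + x) * (θ k + x)) ∂(gaussianReal 0 1) =
      (if e k = 0 then 1 else √(τ:ℝ) * Real.exp (-(s * τ * θ k ^ 2))) * (τ + (θ k * τ) * (θ k * τ)) := by
    intro k h
    have := hG k (fun x => x ^ 2)
    rw [aux_sq] at this
    simp only [h, one_mul, one_ne_zero, if_false, ← pow_two]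
    exact this
  by_cases hij : i = j
  · subst hij
    have : ∀ k, ∫ x, Real.exp (-(s * (e k * (θ k + x) ^ 2))) *
        ((if k = i then (θ k + x) else 1) * (if k = i then (θ k + x) else 1)) ∂(gaussianReal 0 1)
        = (if e k = 0 then 1 else √(τ:ℝ) * Real.exp (-(s * τ * θ k ^ 2))) *
          (if k = i then (τ + (θ k * τ) * (θ k * τ)) else 1) := by
      intro k
      by_cases hk : k = i
      · subst hk
        simp only [if_true]; exact h2 k hi
      · simp only [hk, if_false, mul_one]; exact h0 k
    simp_rw [this, Finset.prod_mul_distrib]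
    simp
  · have : ∀ k, ∫ x, Real.exp (-(s * (e k * (θ k + x) ^ 2))) *
        ((if k = i then (θ k + x) else 1) * (if k = j then (θ k + x) else 1)) ∂(gaussianReal 0 1)
        = (if e k = 0 then 1 else √(τ:ℝ) * Real.exp (-(s * τ * θ k ^ 2))) *
          ((if k = i then θ k * τ else 1) * (if k = j then θ k * τ else 1)) := by
      intro k
      by_cases hk : k = i
      · subst hk
        simp only [if_true, hij, if_false, mul_one]; exact h1 k hi
      · by_cases hk' : k = j
        · subst hk'
          simp only [if_true, hk, if_false, one_mul]; exact h1 k hj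
        · simp only [hk, hk', if_false, mul_one]; exact h0 k
    simp_rw [this, Finset.prod_mul_distrib]
    simp [hij]

/-- Laplace uniqueness. -/
lemma aux_laplace {μ ν : Measure NNReal} [IsFiniteMeasure μ] [IsFiniteMeasure ν]
    (h : ∀ n : ℕ, ∫ x : NNReal, Real.exp (-(n * (x:ℝ))) ∂μ = ∫ x : NNReal, Real.exp (-(n * (x:ℝ))) ∂ν) : μ = ν := by
  let g : BoundedContinuousFunction NNReal ℝ :=
    BoundedContinuousFunction.ofNormedAddCommGroup (fun x : NNReal => Real.exp (-(x:ℝ)))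
      (by fun_prop) 1 (by intro x; simp)
  have hg : ∀ x, g x = Real.exp (-(x:ℝ)) := fun x => rfl
  let A : StarSubalgebra ℝ (BoundedContinuousFunction NNReal ℝ) :=
    { Algebra.adjoin ℝ {g} with
      star_mem' := by
        intro a ha
        have : star a = a := by ext x; simp
        rw [this]; exact ha }
  refine ext_of_forall_mem_subalgebra_integral_eq_of_polish (𝕜 := ℝ) (A := A) ?_ ?_
  · intro x y hxy
    refine ⟨fun z => g z, ⟨_, ⟨g, ?_, rfl⟩, rfl⟩, ?_⟩
    · exact Algebra.subset_adjoin (Set.mem_singleton g)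
    · simp only [hg]
      intro h
      apply hxy
      have := Real.exp_injective h
      exact_mod_cast neg_injective this
  · intro f hf
    have hf' : f ∈ Algebra.adjoin ℝ {g} := hf
    rw [Algebra.adjoin_singleton_eq_range_aeval] at hf'
    obtain ⟨q, rfl⟩ := hf'
    have hsum : ∀ x, (Polynomial.aeval g q) x = ∑ n ∈ q.support, q.coeff n * Real.exp (-(n * (x:ℝ))) := by
      intro x
      rw [Polynomial.aeval_def, Polynomial.eval₂_eq_sum, Polynomial.sum,
        BoundedContinuousFunction.sum_apply]
      refine Finset.sum_congr rfl fun n _ => ?_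
      rw [BoundedContinuousFunction.mul_apply, BoundedContinuousFunction.pow_apply, hg, ← Real.exp_nat_mul]
      simp [Algebra.algebraMap_eq_smul_one]
    have hint : ∀ (ρ : Measure NNReal) [IsFiniteMeasure ρ] (n : ℕ), Integrable (fun x : NNReal => Real.exp (-(n * (x:ℝ)))) ρ := by
      intro ρ _ n
      refine Integrable.of_bound (by fun_prop) 1 (ae_of_all _ fun x => ?_)
      simp; positivity
    change ∫ x, (Polynomial.aeval g q) x ∂μ = ∫ x, (Polynomial.aeval g q) x ∂ν
    simp_rw [hsum]
    rw [integral_finsetSum _ (fun n _ => (hint μ n).const_mul _), integral_finsetSum _ (fun n _ => (hint ν n).const_mul _)]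
    simp_rw [integral_const_mul, h]

lemma aux_key {Ω Ω₁ Ω₂ : Type*} [MeasurableSpace Ω] [MeasurableSpace Ω₁] [MeasurableSpace Ω₂]
    (μ : Measure Ω) (μ₁ : Measure Ω₁) (μ₂ : Measure Ω₂) [IsProbabilityMeasure μ]
    [IsProbabilityMeasure μ₁] [IsProbabilityMeasure μ₂]
    (S f : Ω → ℝ) (T₁ : Ω₁ → ℝ) (T₂ : Ω₂ → ℝ) (hS : Measurable S) (hT₁ : Measurable T₁)
    (hT₂ : Measurable T₂) (hS0 : ∀ x, 0 ≤ S x) (hT₁0 : ∀ x, 0 ≤ T₁ x) (hT₂0 : ∀ x, 0 ≤ T₂ x)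
    (hf : Integrable f μ) (hfm : Measurable f) (hf0 : ∀ x, 0 ≤ f x) (A B : ℝ) (hA : 0 ≤ A) (hB : 0 ≤ B)
    (h : ∀ n : ℕ, ∫ x, Real.exp (-(n * S x)) * f x ∂μ
      = A * ∫ x, Real.exp (-(n * T₁ x)) ∂μ₁ + B * ∫ x, Real.exp (-(n * T₂ x)) ∂μ₂) (c : ℝ) :
    ∫ x, (if S x ≤ c then (1:ℝ) else 0) * f x ∂μ
      = A * (μ₁ {x | T₁ x ≤ c}).toReal + B * (μ₂ {x | T₂ x ≤ c}).toReal := by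
  rcases lt_or_ge c 0 with hc | hc
  · have e0 : ∀ x, ¬ S x ≤ c := fun x hx => by linarith [hS0 x]
    have e1 : ∀ x, ¬ T₁ x ≤ c := fun x hx => by linarith [hT₁0 x]
    have e2 : ∀ x, ¬ T₂ x ≤ c := fun x hx => by linarith [hT₂0 x]
    simp [e0, e1, e2]
  let F : Measure Ω := μ.withDensity (fun x => ENNReal.ofReal (f x))
  have : IsFiniteMeasure F := isFiniteMeasure_withDensity_ofReal hf.2
  have hFint : ∀ g : Ω → ℝ, ∫ x, g x ∂F = ∫ x, g x * f x ∂μ := by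
    intro g
    rw [integral_withDensity_eq_integral_toReal_smul (by fun_prop) (ae_of_all _ fun _ => ENNReal.ofReal_lt_top)]
    refine integral_congr_ae (ae_of_all _ fun x => ?_)
    simp [ENNReal.toReal_ofReal (hf0 x), mul_comm]
  let S' : Ω → NNReal := fun x => (S x).toNNReal
  let T₁' : Ω₁ → NNReal := fun x => (T₁ x).toNNReal
  let T₂' : Ω₂ → NNReal := fun x => (T₂ x).toNNReal
  have mS : Measurable S' := hS.real_toNNReal
  have m1 : Measurable T₁' := hT₁.real_toNNReal
  have m2 : Measurable T₂' := hT₂.real_toNNReal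
  let M := F.map S'
  let N := A.toNNReal • μ₁.map T₁' + B.toNNReal • μ₂.map T₂'
  have : IsFiniteMeasure M := by dsimp [M]; infer_instance
  have : IsFiniteMeasure N := by dsimp [N]; infer_instance
  have key : M = N := by
    apply aux_laplace
    intro n
    have hint : ∀ (ρ : Measure NNReal) [IsFiniteMeasure ρ], Integrable (fun x : NNReal => Real.exp (-(n * (x:ℝ)))) ρ := by
      intro ρ _
      refine Integrable.of_bound (by fun_prop) 1 (ae_of_all _ fun x => ?_)
      simp; positivity
    have hsm : ∀ ρ : Measure NNReal, AEStronglyMeasurable (fun x : NNReal => Real.exp (-(n * (x:ℝ)))) ρ := by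
      intro ρ; fun_prop
    dsimp only [M, N]
    rw [integral_map mS.aemeasurable (hsm _), integral_add_measure (hint _) (hint _),
      integral_smul_nnreal_measure, integral_smul_nnreal_measure,
      integral_map m1.aemeasurable (hsm _), integral_map m2.aemeasurable (hsm _), hFint]
    have := h n
    simp only [S', T₁', T₂', Real.coe_toNNReal _ (hS0 _), Real.coe_toNNReal _ (hT₁0 _),
      Real.coe_toNNReal _ (hT₂0 _), NNReal.smul_def, Real.coe_toNNReal _ hA, Real.coe_toNNReal _ hB, smul_eq_mul]
    exact this
  have hset : MeasurableSet {x : NNReal | (x:ℝ) ≤ c} := measurableSet_le (by fun_prop) (by fun_prop)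
  have hL : M.real {x : NNReal | (x:ℝ) ≤ c} = ∫ x, (if S x ≤ c then (1:ℝ) else 0) * f x ∂μ := by
    rw [← hFint, ← integral_indicator_one hset]
    dsimp only [M]
    rw [integral_map mS.aemeasurable (by
      exact (measurable_one.indicator hset).aestronglyMeasurable)]
    refine integral_congr_ae (ae_of_all _ fun x => ?_)
    simp [S', Set.indicator_apply, Real.coe_toNNReal _ (hS0 x)]
  rw [← hL, key]
  dsimp only [N]
  rw [measureReal_add_apply, measureReal_nnreal_smul_apply, measureReal_nnreal_smul_apply]
  simp only [Measure.real, Measure.map_apply m1 hset, Measure.map_apply m2 hset]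
  simp [T₁', T₂', Real.coe_toNNReal _ (hT₁0 _), Real.coe_toNNReal _ (hT₂0 _), hA, hB]

lemma aux_prod {ι : Type*} [Fintype ι] (g q : ℝ) (e θ : ι → ℝ)
    (he : ∀ k, e k = 0 ∨ e k = 1) :
    ∏ k, (if e k = 0 then 1 else g * Real.exp (-(q * θ k ^ 2)))
      = g ^ (Fintype.card {k // e k ≠ 0}) * Real.exp (-(q * ∑ k, e k * θ k ^ 2)) := by
  have : ∀ k, (if e k = 0 then 1 else g * Real.exp (-(q * θ k ^ 2)))
      = (if e k ≠ 0 then g else 1) * Real.exp (-(q * (e k * θ k ^ 2))) := by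
    intro k
    rcases he k with h | h <;> simp [h]
  simp_rw [this]
  rw [Finset.prod_mul_distrib, ← Real.exp_sum, Finset.sum_neg_distrib, Finset.mul_sum]
  congr 1
  rw [Finset.prod_ite, Fintype.card_subtype]
  simp

/-- Diagonal version. -/
lemma aux_diag {ι : Type*} [Fintype ι] [DecidableEq ι] (e θ β : ι → ℝ)
    (he : ∀ k, e k = 0 ∨ e k = 1) (N : ℕ) (hN : Fintype.card {k // e k ≠ 0} = N)
    (m₂ : Fin (N + 2) → ℝ) (hm₂ : ∑ i, m₂ i ^ 2 = ∑ k, e k * θ k ^ 2)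
    (m₄ : Fin (N + 4) → ℝ) (hm₄ : ∑ i, m₄ i ^ 2 = ∑ k, e k * θ k ^ 2) (c : ℝ) :
    ∫ x, (if ∑ k, e k * (θ k + x k) ^ 2 ≤ c then (1:ℝ) else 0) * (∑ k, e k * β k * (θ k + x k)) ^ 2
      ∂(Measure.pi (fun _ : ι => gaussianReal 0 1))
    = (∑ k, e k * β k ^ 2) * (Measure.pi (fun _ : Fin (N + 2) => gaussianReal 0 1) {v | ∑ k, (m₂ k + v k) ^ 2 ≤ c}).toReal
      + (∑ k, e k * β k * θ k) ^ 2 * (Measure.pi (fun _ : Fin (N + 4) => gaussianReal 0 1) {v | ∑ k, (m₄ k + v k) ^ 2 ≤ c}).toReal := by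
  have he0 : ∀ k, 0 ≤ e k := fun k => by rcases he k with h | h <;> simp [h]
  have hIJ : ∀ i j, Integrable (fun x : ι → ℝ => (θ i + x i) * (θ j + x j)) (Measure.pi (fun _ : ι => gaussianReal 0 1)) :=
    fun i j => (aux_memLp θ i).integrable_mul (aux_memLp θ j)
  have hsq : ∀ x : ι → ℝ, (∑ k, e k * β k * (θ k + x k)) ^ 2 =
      ∑ i, ∑ j, (e i * β i * (e j * β j)) * ((θ i + x i) * (θ j + x j)) := by
    intro x
    rw [pow_two, Finset.sum_mul_sum]
    refine Finset.sum_congr rfl fun i _ => Finset.sum_congr rfl fun j _ => by ring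
  apply aux_key _ _ _ (fun x : ι → ℝ => ∑ k, e k * (θ k + x k) ^ 2) (fun x : ι → ℝ => (∑ k, e k * β k * (θ k + x k)) ^ 2)
    (fun v : Fin (N+2) → ℝ => ∑ k, (m₂ k + v k) ^ 2) (fun v : Fin (N+4) → ℝ => ∑ k, (m₄ k + v k) ^ 2)
    (by fun_prop) (by fun_prop) (by fun_prop)
    (fun x => Finset.sum_nonneg fun k _ => mul_nonneg (he0 k) (sq_nonneg _))
    (fun x => Finset.sum_nonneg fun k _ => sq_nonneg _)
    (fun x => Finset.sum_nonneg fun k _ => sq_nonneg _)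
    ?_ (by fun_prop) (fun x => sq_nonneg _) _ _ (Finset.sum_nonneg fun k _ => mul_nonneg (he0 k) (sq_nonneg _)) (sq_nonneg _)
  · intro n
    set s : ℝ := (n:ℝ) with hsdef
    have hs : 0 ≤ s := Nat.cast_nonneg n
    have g1 := aux_mgf0 s hs (fun _ : Fin (N+2) => 1) m₂ (by simp)
    have g2 := aux_mgf0 s hs (fun _ : Fin (N+4) => 1) m₄ (by simp)
    rw [aux_prod _ _ _ _ (by simp)] at g1 g2
    simp only [one_mul, hm₂, hm₄] at g1 g2
    simp only [ne_eq, one_ne_zero, not_false_eq_true, Fintype.card_subtype_true, Fintype.card_fin] at g1 g2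
    obtain ⟨η, hη⟩ : ∃ η, η = ∑ k, e k * θ k ^ 2 := ⟨_, rfl⟩
    rw [← hη] at g1 g2
    rw [g1, g2]
    have hterm : ∀ i j, ∫ x, Real.exp (-(s * ∑ k, e k * (θ k + x k) ^ 2)) * ((e i * β i * (e j * β j)) * ((θ i + x i) * (θ j + x j)))
        ∂(Measure.pi (fun _ : ι => gaussianReal 0 1)) =
        (e i * β i * (e j * β j)) * ((√(1 / (1 + 2 * s)) ^ N * Real.exp (-(s * (1 / (1 + 2 * s)) * η))) *
          ((if i = j then 1 / (1 + 2 * s) else 0) + (θ i * (1 / (1 + 2 * s))) * (θ j * (1 / (1 + 2 * s))))) := by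
      intro i j
      rcases he i with hi | hi
      · simp [hi]
      rcases he j with hj | hj
      · simp [hj]
      have := aux_mgf2 s hs e θ he i j hi hj
      rw [aux_prod _ _ _ _ he, hN, ← hη] at this
      rw [← this, ← integral_const_mul]
      congr 1; ext x; ring
    have hint : ∀ i j, Integrable (fun x : ι → ℝ => Real.exp (-(s * ∑ k, e k * (θ k + x k) ^ 2)) * ((e i * β i * (e j * β j)) * ((θ i + x i) * (θ j + x j))))
        (Measure.pi (fun _ : ι => gaussianReal 0 1)) := by
      intro i j
      refine Integrable.bdd_mul (c := 1) ((hIJ i j).const_mul _)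
        (Measurable.aestronglyMeasurable (by fun_prop)) (ae_of_all _ fun x => ?_)
      simp only [Real.norm_eq_abs, Real.abs_exp, Real.exp_le_one_iff, Left.neg_nonpos_iff]
      exact mul_nonneg hs (Finset.sum_nonneg fun k _ => mul_nonneg (he0 k) (sq_nonneg _))
    simp_rw [hsq, Finset.mul_sum]
    simp_rw [← Finset.mul_sum (s := Finset.univ) (a := s)]
    rw [integral_finsetSum _ (fun i _ => integrable_finsetSum _ fun j _ => hint i j)]
    simp_rw [integral_finsetSum _ (fun j _ => hint _ j), hterm]
    have hτ : √(1 / (1 + 2 * s)) ^ 2 = 1 / (1 + 2 * s) := Real.sq_sqrt (by positivity)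
    have hτ4 : √(1 / (1 + 2 * s)) ^ 4 = (1 / (1 + 2 * s)) ^ 2 := by
      calc _ = (√(1 / (1 + 2 * s)) ^ 2) ^ 2 := by ring
        _ = _ := by rw [hτ]
    rw [pow_add, pow_add, hτ, hτ4]
    generalize √(1 / (1 + 2 * s)) ^ N = G
    generalize Real.exp (-(s * (1 / (1 + 2 * s)) * η)) = E
    generalize 1 / (1 + 2 * s) = τ
    have : ∀ i j, e i * β i * (e j * β j) * (G * E * ((if i = j then τ else 0) + θ i * τ * (θ j * τ)))
      = (if i = j then (e i * β i ^ 2) * (G * E * τ) else 0) + (G * E * τ ^ 2) * ((e i * β i * θ i) * (e j * β j * θ j)) := by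
      intro i j
      split_ifs with h
      · subst h
        rcases he i with h | h <;> simp [h] <;> ring
      · ring
    simp_rw [this, Finset.sum_add_distrib, ← Finset.mul_sum, Finset.sum_ite_eq, Finset.mem_univ, if_true, ← Finset.sum_mul]
    ring
  · simp_rw [hsq]
    exact integrable_finsetSum _ fun i _ => integrable_finsetSum _ fun j _ => (hIJ i j).const_mul _

lemma aux_spec {p : ℕ} (P : Matrix (Fin p) (Fin p) ℝ) (hsym : Pᵀ = P) (hidem : P * P = P) :
    ∃ (O : Matrix (Fin p) (Fin p) ℝ) (e : Fin p → ℝ), Oᵀ * O = 1 ∧ P = O * diagonal e * Oᵀ ∧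
      (∀ k, e k = 0 ∨ e k = 1) ∧ Fintype.card {k // e k ≠ 0} = P.rank ∧
      Measure.map (fun x => O *ᵥ x) (Measure.pi (fun _ : Fin p => gaussianReal 0 1))
        = Measure.pi (fun _ : Fin p => gaussianReal 0 1) := by
  have hA : P.IsHermitian := by
    rw [Matrix.IsHermitian, conjTranspose_eq_transpose_of_trivial, hsym]
  have hO : (hA.eigenvectorUnitary : Matrix (Fin p) (Fin p) ℝ)ᵀ * (hA.eigenvectorUnitary : Matrix (Fin p) (Fin p) ℝ) = 1 := by
    have := Unitary.coe_star_mul_self hA.eigenvectorUnitary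
    rwa [star_eq_conjTranspose, conjTranspose_eq_transpose_of_trivial] at this
  have hP : P = (hA.eigenvectorUnitary : Matrix (Fin p) (Fin p) ℝ) * diagonal hA.eigenvalues
      * (hA.eigenvectorUnitary : Matrix (Fin p) (Fin p) ℝ)ᵀ := by
    have := hA.spectral_theorem
    rw [Unitary.conjStarAlgAut_apply, star_eq_conjTranspose, conjTranspose_eq_transpose_of_trivial] at this
    exact this
  refine ⟨(hA.eigenvectorUnitary : Matrix (Fin p) (Fin p) ℝ), hA.eigenvalues, hO, hP, ?_, ?_, ?_⟩
  · have h2 : diagonal hA.eigenvalues * diagonal hA.eigenvalues = diagonal hA.eigenvalues := by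
      set O := (hA.eigenvectorUnitary : Matrix (Fin p) (Fin p) ℝ)
      set d := diagonal hA.eigenvalues with hd
      have hd' : d = Oᵀ * P * O := by
        conv_rhs => rw [hP]
        calc d = (1 : Matrix (Fin p) (Fin p) ℝ) * d * 1 := by simp
          _ = (Oᵀ * O) * d * (Oᵀ * O) := by rw [hO]
          _ = _ := by simp only [Matrix.mul_assoc]
      have hO' : O * Oᵀ = 1 := mul_eq_one_comm.1 hO
      calc d * d = Oᵀ * P * (O * Oᵀ) * P * O := by rw [hd']; simp only [Matrix.mul_assoc]
        _ = Oᵀ * (P * P) * O := by rw [hO']; simp only [Matrix.mul_assoc, Matrix.one_mul]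
        _ = d := by rw [hidem, ← hd']
    intro k
    rw [diagonal_mul_diagonal] at h2
    have h3 := congrFun (diagonal_injective h2) k
    have : hA.eigenvalues k * (hA.eigenvalues k - 1) = 0 := by
      linarith
    rcases mul_eq_zero.1 this with h | h
    · exact Or.inl h
    · right; linarith
  · exact hA.rank_eq_card_non_zero_eigs.symm
  · have h1 := map_pi_eq_stdGaussian (ι := Fin p)
    rw [stdGaussian_eq_map_pi_orthonormalBasis hA.eigenvectorBasis] at h1
    have h2 := congrArg (Measure.map (fun y : EuclideanSpace ℝ (Fin p) => (WithLp.ofLp y : Fin p → ℝ))) h1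
    rw [Measure.map_map (by fun_prop) (by fun_prop), Measure.map_map (by fun_prop) (by fun_prop)] at h2
    have h3 : ((fun y : EuclideanSpace ℝ (Fin p) => (WithLp.ofLp y : Fin p → ℝ)) ∘ WithLp.toLp 2) = id := rfl
    rw [h3, Measure.map_id] at h2
    conv_rhs => rw [h2]
    congr 1
    ext x i
    simp [Matrix.mulVec, dotProduct, mul_comm]

lemma aux_quad (p r : ℕ)
    (P : Matrix (Fin p) (Fin p) ℝ) (hsym : Pᵀ = P) (hidem : P * P = P)
    (hrank : P.rank = p - r)
    (μ₀ : Fin p → ℝ) (c : ℝ)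
    (m₂ : Fin (p - r + 2) → ℝ) (hm₂ : ∑ i, m₂ i ^ 2 = μ₀ ⬝ᵥ P.mulVec μ₀)
    (m₄ : Fin (p - r + 4) → ℝ) (hm₄ : ∑ i, m₄ i ^ 2 = μ₀ ⬝ᵥ P.mulVec μ₀) (a : Fin p → ℝ) :
    ∫ w, (if ∑ k, (P.mulVec μ₀ k + P.mulVec w k) ^ 2 ≤ c then (1 : ℝ) else 0)
            * (a ⬝ᵥ (P *ᵥ μ₀ + P *ᵥ w)) ^ 2 ∂(Measure.pi (fun _ : Fin p => gaussianReal 0 1))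
      = (a ⬝ᵥ P *ᵥ a) * (Measure.pi (fun _ : Fin (p - r + 2) => gaussianReal 0 1) {v | ∑ k, (m₂ k + v k) ^ 2 ≤ c}).toReal
        + (a ⬝ᵥ P *ᵥ μ₀) ^ 2 * (Measure.pi (fun _ : Fin (p - r + 4) => gaussianReal 0 1) {v | ∑ k, (m₄ k + v k) ^ 2 ≤ c}).toReal := by
  obtain ⟨O, e, hO, hP, he, hcard, hmap⟩ := aux_spec P hsym hidem
  have F1 : ∀ u v : Fin p → ℝ, u ⬝ᵥ P *ᵥ v = ∑ k, e k * (Oᵀ *ᵥ u) k * (Oᵀ *ᵥ v) k := by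
    intro u v
    rw [hP, Matrix.mul_assoc, ← mulVec_mulVec, dotProduct_mulVec, ← mulVec_transpose, ← mulVec_mulVec]
    simp only [dotProduct, mulVec_diagonal]
    exact Finset.sum_congr rfl fun k _ => by ring
  have F2 : ∀ u : Fin p → ℝ, (P *ᵥ u) ⬝ᵥ (P *ᵥ u) = u ⬝ᵥ P *ᵥ u := by
    intro u
    rw [dotProduct_mulVec, ← mulVec_transpose, hsym, mulVec_mulVec, hidem, dotProduct_comm]
  have F3 : ∀ x, Oᵀ *ᵥ (μ₀ + O *ᵥ x) = Oᵀ *ᵥ μ₀ + x := by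
    intro x
    rw [mulVec_add, mulVec_mulVec, hO, one_mulVec]
  have F4 : ∀ w, ∑ k, (P.mulVec μ₀ k + P.mulVec w k) ^ 2 = (μ₀ + w) ⬝ᵥ P *ᵥ (μ₀ + w) := by
    intro w
    rw [← F2, mulVec_add]
    simp [dotProduct, pow_two]
  have key := aux_diag e (Oᵀ *ᵥ μ₀) (Oᵀ *ᵥ a) he (p - r) (hcard.trans hrank) m₂
    (by rw [hm₂, F1]; exact Finset.sum_congr rfl fun k _ => by ring) m₄
    (by rw [hm₄, F1]; exact Finset.sum_congr rfl fun k _ => by ring) c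
  rw [F1, F1]
  have e1 : ∑ k, e k * (Oᵀ *ᵥ a) k * (Oᵀ *ᵥ a) k = ∑ k, e k * (Oᵀ *ᵥ a) k ^ 2 :=
    Finset.sum_congr rfl fun k _ => by ring
  rw [e1, ← key]
  simp_rw [F4, ← mulVec_add]
  conv_lhs => rw [← hmap]
  rw [integral_map (by fun_prop)]
  · refine integral_congr_ae (ae_of_all _ fun x => ?_)
    simp only [F1, F3, Pi.add_apply]
    have e2 : ∑ k, e k * ((Oᵀ *ᵥ μ₀) k + x k) * ((Oᵀ *ᵥ μ₀) k + x k)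
      = ∑ k, e k * ((Oᵀ *ᵥ μ₀) k + x k) ^ 2 := Finset.sum_congr rfl fun k _ => by ring
    rw [e2]
  · apply Measurable.aestronglyMeasurable
    refine Measurable.mul (Measurable.ite (measurableSet_le ?_ measurable_const) measurable_const measurable_const) ?_
    all_goals
      simp only [dotProduct, mulVec]
      fun_prop

theorem stmt9 (p r : ℕ) (hr : r ≤ p)
    (P : Matrix (Fin p) (Fin p) ℝ) (hsym : Pᵀ = P) (hidem : P * P = P)
    (hrank : P.rank = p - r)
    (μ₀ : Fin p → ℝ) (c : ℝ)
    (m₂ : Fin (p - r + 2) → ℝ) (hm₂ : ∑ i, m₂ i ^ 2 = μ₀ ⬝ᵥ P.mulVec μ₀)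
    (m₄ : Fin (p - r + 4) → ℝ) (hm₄ : ∑ i, m₄ i ^ 2 = μ₀ ⬝ᵥ P.mulVec μ₀) :
    ∀ i j, ∫ w, (if ∑ k, (P.mulVec μ₀ k + P.mulVec w k) ^ 2 ≤ c then (1 : ℝ) else 0)
            * ((P.mulVec μ₀ i + P.mulVec w i) * (P.mulVec μ₀ j + P.mulVec w j))
            ∂(stdGaussian p)
      = ((stdGaussian (p - r + 2)) {v | ∑ k, (m₂ k + v k) ^ 2 ≤ c}).toReal * P i j
        + ((stdGaussian (p - r + 4)) {v | ∑ k, (m₄ k + v k) ^ 2 ≤ c}).toReal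
            * (P.mulVec μ₀ i * P.mulVec μ₀ j) := by
  intro i j
  simp only [_root_.stdGaussian]
  have Q := aux_quad p r P hsym hidem hrank μ₀ c m₂ hm₂ m₄ hm₄
  have hL : ∀ k, MemLp (fun w : Fin p → ℝ => P.mulVec μ₀ k + P.mulVec w k) 2
      (Measure.pi (fun _ : Fin p => gaussianReal 0 1)) := by
    intro k
    have h0 : ∀ l, MemLp (fun w : Fin p → ℝ => w l) 2
        (Measure.pi (fun _ : Fin p => gaussianReal 0 1)) := fun l => by
      simpa using aux_memLp (fun _ : Fin p => (0:ℝ)) l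
    have h1 : MemLp (fun w : Fin p → ℝ => P.mulVec w k) 2
        (Measure.pi (fun _ : Fin p => gaussianReal 0 1)) := by
      simp only [mulVec, dotProduct]
      exact memLp_finsetSum Finset.univ fun l _ => MemLp.const_mul (h0 l) (P k l)
    have h2 : MemLp (fun _ : Fin p → ℝ => P.mulVec μ₀ k) 2
        (Measure.pi (fun _ : Fin p => gaussianReal 0 1)) := memLp_const _
    exact h2.add h1
  have hInt : ∀ a : Fin p → ℝ, Integrable (fun w : Fin p → ℝ =>
      (if ∑ k, (P.mulVec μ₀ k + P.mulVec w k) ^ 2 ≤ c then (1 : ℝ) else 0)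
            * (a ⬝ᵥ (P *ᵥ μ₀ + P *ᵥ w)) ^ 2) (Measure.pi (fun _ : Fin p => gaussianReal 0 1)) := by
    intro a
    have h2 : MemLp (fun w : Fin p → ℝ => a ⬝ᵥ (P *ᵥ μ₀ + P *ᵥ w)) 2
      (Measure.pi (fun _ : Fin p => gaussianReal 0 1)) := by
      simp only [dotProduct, Pi.add_apply]
      exact memLp_finsetSum _ fun l _ => MemLp.const_mul (hL l) _
    refine Integrable.bdd_mul (c := 1) h2.integrable_sq ?_ (ae_of_all _ fun w => ?_)
    · apply Measurable.aestronglyMeasurable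
      refine Measurable.ite (measurableSet_le ?_ measurable_const) measurable_const measurable_const
      simp only [dotProduct, mulVec]
      fun_prop
    · split_ifs <;> simp
  have hpol : ∀ w : Fin p → ℝ, (if ∑ k, (P.mulVec μ₀ k + P.mulVec w k) ^ 2 ≤ c then (1 : ℝ) else 0)
            * ((P.mulVec μ₀ i + P.mulVec w i) * (P.mulVec μ₀ j + P.mulVec w j))
      = (1/4) * ((if ∑ k, (P.mulVec μ₀ k + P.mulVec w k) ^ 2 ≤ c then (1 : ℝ) else 0)
            * ((Pi.single i 1 + Pi.single j 1) ⬝ᵥ (P *ᵥ μ₀ + P *ᵥ w)) ^ 2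
        - (if ∑ k, (P.mulVec μ₀ k + P.mulVec w k) ^ 2 ≤ c then (1 : ℝ) else 0)
            * ((Pi.single i 1 - Pi.single j 1) ⬝ᵥ (P *ᵥ μ₀ + P *ᵥ w)) ^ 2) := by
    intro w
    simp only [add_dotProduct, sub_dotProduct, single_one_dotProduct, Pi.add_apply]
    ring
  simp_rw [hpol]
  rw [integral_const_mul, integral_sub (hInt _) (hInt _), Q, Q]
  have hs : P j i = P i j := by conv_lhs => rw [← hsym, transpose_apply]
  simp only [add_dotProduct, sub_dotProduct, single_one_dotProduct, mulVec_add, mulVec_sub, Pi.add_apply,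
    Pi.sub_apply, mulVec_single_one, col_apply, hs]
  ring
end
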